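/- arXiv:1810.04298 — 4 statements merged into one kernel-verified Lean document; each statement's English description precedes it below -/
import Mathlib

section
/- Let 0 < η ≤ 1, b > 1, and let Λ satisfy 0 < Λ < η·log₂ b. If a [0,1]-martingale X_0, X_1, X_2, … is (η,b)-exponentially locally polarizing, then it satisfies Λ-exponentially strong polarization. -/
open MeasureTheory

/- The σ-algebra generated by `X_0, …, X_t`. -/
def pastSigma {Ω : Type} (X : ℕ → Ω → ℝ) (t : ℕ) : MeasurableSpace Ω :=
  MeasurableSpace.comap (fun ω (i : Fin (t + 1)) => X i ω) inferInstance

open scoped ENNReal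

/-- Conditioning inside a Lebesgue integral against a weight measurable with respect to the
smaller σ-algebra. -/
theorem lintegral_mul_ofReal_condExp {Ω : Type*} {m m0 : MeasurableSpace Ω} {μ : Measure Ω}
    [IsFiniteMeasure μ] (hm : m ≤ m0) {h : Ω → ℝ≥0∞} (hh : Measurable[m] h) {Z : Ω → ℝ}
    (hZ : Integrable Z μ) (hZ0 : 0 ≤ᵐ[μ] Z) :
    ∫⁻ ω, h ω * ENNReal.ofReal (Z ω) ∂μ = ∫⁻ ω, h ω * ENNReal.ofReal ((μ[Z | m]) ω) ∂μ := by
  have hc : Integrable (μ[Z | m]) μ := integrable_condExp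
  have hc0 : 0 ≤ᵐ[μ] μ[Z | m] := condExp_nonneg hZ0
  have key : ∀ W : Ω → ℝ, Integrable W μ →
      ∫⁻ ω, h ω * ENNReal.ofReal (W ω) ∂μ
        = ∫⁻ ω, h ω ∂((μ.withDensity fun ω => ENNReal.ofReal (W ω)).trim hm) := by
    intro W hW
    rw [lintegral_trim hm hh, lintegral_withDensity_eq_lintegral_mul₀
      hW.aestronglyMeasurable.aemeasurable.ennreal_ofReal (hh.mono hm le_rfl).aemeasurable]
    simp [mul_comm]
  rw [key Z hZ, key _ hc]
  congr 1
  refine @Measure.ext _ m _ _ fun T hT => ?_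
  rw [trim_measurableSet_eq hm hT, trim_measurableSet_eq hm hT, withDensity_apply _ (hm _ hT),
    withDensity_apply _ (hm _ hT),
    ← ofReal_integral_eq_lintegral_ofReal hZ.integrableOn (ae_restrict_of_ae hZ0),
    ← ofReal_integral_eq_lintegral_ofReal hc.integrableOn (ae_restrict_of_ae hc0),
    setIntegral_condExp hm hZ hT]

/-- A conditional upper bound can be integrated against a weight measurable with respect to the
smaller σ-algebra. -/
theorem setLIntegral_mul_ofReal_le {Ω : Type*} {m m0 : MeasurableSpace Ω} {μ : Measure Ω}
    [IsFiniteMeasure μ] (hm : m ≤ m0) {S : Set Ω} (hS : MeasurableSet[m] S) {h : Ω → ℝ≥0∞}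
    (hh : Measurable[m] h) {Z g : Ω → ℝ} (hZ : Integrable Z μ) (hZ0 : 0 ≤ᵐ[μ] Z)
    (hg : ∀ᵐ ω ∂μ, ω ∈ S → (μ[Z | m]) ω ≤ g ω) :
    ∫⁻ ω in S, h ω * ENNReal.ofReal (Z ω) ∂μ ≤ ∫⁻ ω in S, h ω * ENNReal.ofReal (g ω) ∂μ := by
  have e : ∀ W : Ω → ℝ, ∫⁻ ω in S, h ω * ENNReal.ofReal (W ω) ∂μ
      = ∫⁻ ω, S.indicator h ω * ENNReal.ofReal (W ω) ∂μ := by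
    intro W
    rw [← lintegral_indicator (hm _ hS)]
    refine lintegral_congr fun ω => ?_
    by_cases hω : ω ∈ S <;> simp [hω]
  rw [e, e, lintegral_mul_ofReal_condExp hm (hh.indicator hS) hZ hZ0]
  refine lintegral_mono_ae ?_
  filter_upwards [hg] with ω hω
  by_cases h' : ω ∈ S
  · gcongr
    exact hω h'
  · simp [h']

/-- One-step drift estimate: a pointwise bound of `F` by `f`, an unlikely event `Bᶜ` and the
growth factor `Z / g` gives a contraction of the integrals. -/
theorem setLIntegral_drift_le {Ω : Type*} {m m0 : MeasurableSpace Ω} {μ : Measure Ω}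
    [IsFiniteMeasure μ] (hm : m ≤ m0) {S : Set Ω} (hS : MeasurableSet[m] S)
    {F f g Z : Ω → ℝ} {B : Set Ω} (hB : MeasurableSet B)
    (hf : Measurable[m] f) (hg : Measurable[m] g)
    (hf0 : ∀ᵐ ω ∂μ, ω ∈ S → 0 ≤ f ω) (hg0 : ∀ᵐ ω ∂μ, 0 ≤ g ω)
    (hZ : Integrable Z μ) (hZ0 : 0 ≤ᵐ[μ] Z) {a b κ ν δ : ℝ} (ha : 0 ≤ a) (hb : 0 ≤ b)
    (hκ1 : κ ≤ 1) (hν0 : 0 ≤ ν) (hδ : 0 ≤ δ)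
    (hκ : ∀ᵐ ω ∂μ, ω ∈ S → κ ≤ (μ[B.indicator (fun _ => (1 : ℝ)) | m]) ω)
    (hν : ∀ᵐ ω ∂μ, ω ∈ S → (μ[Z | m]) ω ≤ ν * g ω)
    (hF : ∀ᵐ ω ∂μ, ω ∈ S → 0 < g ω →
      F ω ≤ f ω * (a + b * (1 - B.indicator (fun _ => (1 : ℝ)) ω) + δ * (Z ω / g ω)))
    (hF0 : ∀ᵐ ω ∂μ, ω ∈ S → Z ω = 0 → F ω ≤ 0) :
    ∫⁻ ω in S, ENNReal.ofReal (F ω) ∂μ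
      ≤ ENNReal.ofReal (a + b * (1 - κ) + δ * ν) * ∫⁻ ω in S, ENNReal.ofReal (f ω) ∂μ := by
  have hSm : MeasurableSet S := hm _ hS
  have hBi : Integrable (B.indicator fun _ => (1 : ℝ)) μ := (integrable_const 1).indicator hB
  set Y : Ω → ℝ := fun ω => 1 - B.indicator (fun _ => (1 : ℝ)) ω with hY
  have hYi : Integrable Y μ := (integrable_const 1).sub hBi
  have hY0 : ∀ ω, 0 ≤ Y ω := by
    intro ω
    by_cases h : ω ∈ B <;> simp [hY, h]
  have hYc : ∀ᵐ ω ∂μ, ω ∈ S → (μ[Y | m]) ω ≤ 1 - κ := by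
    have h1 : μ[Y | m] =ᵐ[μ] μ[fun _ => (1 : ℝ) | m]
        - μ[B.indicator (fun _ => (1 : ℝ)) | m] :=
      condExp_sub (integrable_const 1) hBi m
    rw [condExp_const hm] at h1
    filter_upwards [h1, hκ] with ω h h' hω
    have := h' hω
    simp only [h, Pi.sub_apply]
    linarith
  have hZg : ∀ᵐ ω ∂μ, ω ∈ S → g ω = 0 → Z ω = 0 := by
    set T := S ∩ {ω | g ω = 0} with hT
    have hTm : MeasurableSet[m] T := hS.inter (hg (measurableSet_singleton 0))
    have h1 := setLIntegral_mul_ofReal_le (μ := μ) hm hTm (h := fun _ => 1) measurable_const hZ hZ0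
      (g := fun _ => 0) (by
        filter_upwards [hν] with ω h hω
        simpa [show g ω = 0 from hω.2] using h hω.1)
    simp only [one_mul, ENNReal.ofReal_zero, lintegral_zero, nonpos_iff_eq_zero] at h1
    rw [lintegral_eq_zero_iff' (hZ.aestronglyMeasurable.aemeasurable.ennreal_ofReal.restrict)] at h1
    have h2 := (ae_restrict_iff' (hm _ hTm)).1 h1
    filter_upwards [h2, hZ0] with ω h h0 hω hgω
    have := h ⟨hω, hgω⟩
    simp only [Pi.zero_apply, ENNReal.ofReal_eq_zero] at this
    exact le_antisymm this h0
  have hfm : Measurable f := hf.mono hm le_rfl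
  have hgm : Measurable g := hg.mono hm le_rfl
  have bound : ∫⁻ ω in S, ENNReal.ofReal (F ω) ∂μ ≤
      ∫⁻ ω in S, (ENNReal.ofReal (a * f ω) + ENNReal.ofReal (b * f ω) * ENNReal.ofReal (Y ω)
        + ENNReal.ofReal (δ * (f ω / g ω)) * ENNReal.ofReal (Z ω)) ∂μ := by
    refine setLIntegral_mono_ae' hSm ?_
    filter_upwards [hF, hF0, hf0, hg0, hZ0, hZg] with ω h1 h2 h3 h4 h5 h6 hω
    rcases (h4 : 0 ≤ g ω).eq_or_lt with hz | hp
    · rw [ENNReal.ofReal_of_nonpos (h2 hω (h6 hω hz.symm))]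
      exact zero_le
    · have h3 := h3 hω
      rw [← ENNReal.ofReal_mul (by positivity), ← ENNReal.ofReal_mul (by positivity),
        ← ENNReal.ofReal_add (by positivity) (mul_nonneg (by positivity) (hY0 ω)),
        ← ENNReal.ofReal_add (add_nonneg (by positivity) (mul_nonneg (by positivity) (hY0 ω)))
          (mul_nonneg (by positivity) h5)]
      refine ENNReal.ofReal_le_ofReal ((h1 hω hp).trans (le_of_eq ?_))
      simp only [hY]
      ring
  refine bound.trans ?_
  have hm1 : Measurable[m] fun ω => ENNReal.ofReal (b * f ω) := (hf.const_mul b).ennreal_ofReal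
  have hm2 : Measurable[m] fun ω => ENNReal.ofReal (δ * (f ω / g ω)) :=
    ((hf.div hg).const_mul δ).ennreal_ofReal
  have hZm := hZ.aestronglyMeasurable.aemeasurable.ennreal_ofReal
  have hmZ : AEMeasurable
      (fun ω => ENNReal.ofReal (δ * (f ω / g ω)) * ENNReal.ofReal (Z ω)) (μ.restrict S) :=
    ((hm2.mono hm le_rfl).aemeasurable.mul hZm).restrict
  rw [lintegral_add_right' _ hmZ,
    lintegral_add_left (hfm.const_mul a).ennreal_ofReal]
  have t2 := setLIntegral_mul_ofReal_le (μ := μ) hm hS hm1 hYi (.of_forall hY0) hYc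
  have t3 := setLIntegral_mul_ofReal_le (μ := μ) hm hS hm2 hZ hZ0 hν
  have t3' : ∫⁻ ω in S, ENNReal.ofReal (δ * (f ω / g ω)) * ENNReal.ofReal (ν * g ω) ∂μ
      ≤ ∫⁻ ω in S, ENNReal.ofReal (δ * ν * f ω) ∂μ := by
    refine setLIntegral_mono_ae' hSm ?_
    filter_upwards [hf0, hg0] with ω h1 h2 hω
    have h1 := h1 hω
    rw [← ENNReal.ofReal_mul (by positivity)]
    refine ENNReal.ofReal_le_ofReal ?_
    rcases (h2 : 0 ≤ g ω).eq_or_lt with hz | hp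
    · rw [← hz]; simp; positivity
    · refine le_of_eq ?_
      field_simp
  refine (add_le_add (add_le_add le_rfl t2) (t3.trans t3')).trans (le_of_eq ?_)
  have h1κ : 0 ≤ 1 - κ := by linarith
  have pull : ∀ c : ℝ, 0 ≤ c → ∫⁻ ω in S, ENNReal.ofReal (c * f ω) ∂μ
      = ENNReal.ofReal c * ∫⁻ ω in S, ENNReal.ofReal (f ω) ∂μ := by
    intro c hc
    simp_rw [ENNReal.ofReal_mul hc]
    exact lintegral_const_mul _ hfm.ennreal_ofReal
  rw [lintegral_mul_const _ (hm1.mono hm le_rfl), pull a ha, pull b hb, pull _ (mul_nonneg hδ hν0),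
    ENNReal.ofReal_add (by positivity) (by positivity), ENNReal.ofReal_add ha (by positivity),
    ENNReal.ofReal_mul (q := 1 - κ) hb]
  ring

theorem Real.rpow_le_one_sub_add_mul {r s : ℝ} (hr : 0 ≤ r) (hs0 : 0 ≤ s) (hs1 : s ≤ 1) :
    r ^ s ≤ 1 - s + s * r := by
  have := rpow_one_add_le_one_add_mul_self (s := r - 1) (by linarith) hs0 hs1
  simp only [add_sub_cancel] at this
  linarith

theorem Real.rpow_le_mul_of_suction {w w₀ s C i : ℝ} (hw : 0 ≤ w) (hw₀ : 0 < w₀) (hs0 : 0 < s)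
    (hs1 : s ≤ 1) (hC : 1 ≤ C) (hi : i = 0 ∨ i = 1 ∧ w ≤ w₀ / C) :
    w ^ s ≤ w₀ ^ s * (C ^ (-s) + (1 - C ^ (-s)) * (1 - i) + s * (w / w₀)) := by
  have hC0 : 0 < C := by linarith
  have e : w ^ s = w₀ ^ s * (w / w₀) ^ s := by
    rw [Real.div_rpow hw hw₀.le]
    field_simp
  rw [e]
  gcongr
  rcases hi with rfl | ⟨rfl, h⟩
  · have := Real.rpow_le_one_sub_add_mul (r := w / w₀) (by positivity) hs0.le hs1
    linarith
  · have h1 : w / w₀ ≤ C⁻¹ := by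
      rw [div_le_iff₀ hw₀]
      calc w ≤ w₀ / C := h
        _ = C⁻¹ * w₀ := by ring
    have h2 : (w / w₀) ^ s ≤ C⁻¹ ^ s := Real.rpow_le_rpow (by positivity) h1 hs0.le
    rw [Real.inv_rpow hC0.le, ← Real.rpow_neg hC0.le] at h2
    have : 0 ≤ s * (w / w₀) := by positivity
    linarith

theorem Real.neg_log_rpow_le_mul {x y s b τ i : ℝ} (hx : 0 < x) (hxτ : x ≤ τ) (hy : 0 ≤ y)
    (hyτ : y ≤ τ) (hτ : τ < 1) (hs0 : 0 < s) (hs1 : s ≤ 1) (hb : 1 ≤ b)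
    (hi : i = 0 ∨ i = 1 ∧ y ≤ x ^ b) :
    (-Real.log y) ^ (-s) ≤ (-Real.log x) ^ (-s) *
      (b ^ (-s) + (1 - b ^ (-s)) * (1 - i) + (-Real.log τ)⁻¹ * (y / x)) := by
  have hτ0 : 0 < τ := hx.trans_le hxτ
  have hb0 : 0 < b := by linarith
  have hLτ : 0 < -Real.log τ := by linarith [Real.log_neg hτ0 hτ]
  have hLx : -Real.log τ ≤ -Real.log x := by linarith [Real.log_le_log hx hxτ]
  have hLx0 : 0 < -Real.log x := by linarith
  have hbs : b ^ (-s) ≤ 1 := Real.rpow_le_one_of_one_le_of_nonpos hb (by linarith)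
  have hbs0 : 0 < b ^ (-s) := Real.rpow_pos_of_pos hb0 _
  have hnn : 0 ≤ (-Real.log τ)⁻¹ * (y / x) := by positivity
  rcases hy.eq_or_lt with rfl | hy
  · rw [Real.log_zero, neg_zero, Real.zero_rpow (by linarith)]
    refine mul_nonneg (by positivity) ?_
    rcases hi with rfl | ⟨rfl, -⟩ <;> simp
    positivity
  have hLy : -Real.log τ ≤ -Real.log y := by linarith [Real.log_le_log hy hyτ]
  have hLy0 : 0 < -Real.log y := by linarith
  rcases hi with rfl | ⟨rfl, h⟩
  · have e : (-Real.log y) ^ (-s)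
        = (-Real.log x) ^ (-s) * (-Real.log x / -Real.log y) ^ s := by
      rw [Real.div_rpow hLx0.le hLy0.le, Real.rpow_neg hLx0.le, Real.rpow_neg hLy0.le]
      have := Real.rpow_pos_of_pos hLx0 s
      field_simp
    rw [e]
    gcongr
    have key : (-Real.log x / -Real.log y) ^ s ≤ 1 + (-Real.log τ)⁻¹ * (y / x) := by
      rcases le_total (-Real.log x) (-Real.log y) with hle | hle
      · have : (-Real.log x / -Real.log y) ^ s ≤ 1 :=
          Real.rpow_le_one (by positivity) ((div_le_one hLy0).2 hle) hs0.le
        linarith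
      · have h1 : 1 ≤ -Real.log x / -Real.log y := (one_le_div hLy0).2 hle
        have h2 : (-Real.log x / -Real.log y) ^ s ≤ -Real.log x / -Real.log y := by
          simpa using Real.rpow_le_rpow_of_exponent_le h1 hs1
        have h3 : Real.log (y / x) ≤ y / x :=
          (Real.log_le_sub_one_of_pos (by positivity)).trans (by linarith)
        rw [Real.log_div hy.ne' hx.ne'] at h3
        have h4 : -Real.log x / -Real.log y = 1 + (-Real.log y)⁻¹ * (Real.log y - Real.log x) := by
          have : Real.log y ≠ 0 := by linarith
          field_simp
          ring
        have h5 : (-Real.log y)⁻¹ ≤ (-Real.log τ)⁻¹ := inv_anti₀ hLτ hLy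
        have h6 : (-Real.log y)⁻¹ * (Real.log y - Real.log x) ≤ (-Real.log τ)⁻¹ * (y / x) :=
          mul_le_mul h5 h3 (by linarith) (by positivity)
        linarith
    linarith
  · have h1 : b * -Real.log x ≤ -Real.log y := by
      have := Real.log_le_log hy h
      rw [Real.log_rpow hx] at this
      linarith
    have h2 : (-Real.log y) ^ (-s) ≤ (b * -Real.log x) ^ (-s) :=
      Real.rpow_le_rpow_of_nonpos (by positivity) h1 (by linarith)
    rw [Real.mul_rpow hb0.le hLx0.le] at h2
    refine h2.trans ?_
    rw [mul_comm]
    gcongr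
    linarith

theorem exists_exp_mul_exp_le_pow {κ β : ℝ} (hβ : 0 ≤ β) (hκ : β < κ) :
    ∃ m : ℕ, 0 < m ∧ ∃ σ : ℝ, 0 < σ ∧ σ < 1 ∧ ∀ n k : ℕ, n * m ≤ n + k →
      Real.exp (-κ) ^ k * Real.exp (β * (n + k : ℕ)) ≤ σ ^ (n + k) := by
  have hκ0 : 0 < κ := by linarith
  obtain ⟨m, hm⟩ := exists_nat_gt (2 * κ / (κ - β))
  have hd : 0 < κ - β := by linarith
  have hm0 : (0 : ℝ) < m := lt_trans (by positivity) hm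
  refine ⟨m, by exact_mod_cast hm0, Real.exp (-((κ - β) / 2)), Real.exp_pos _, ?_, ?_⟩
  · rw [Real.exp_lt_one_iff]; linarith
  intro n k hnk
  rw [← Real.exp_nat_mul, ← Real.exp_add, ← Real.exp_nat_mul]
  apply Real.exp_le_exp.2
  have h1 : (n : ℝ) * m ≤ n + k := by exact_mod_cast hnk
  have h2 : 2 * κ ≤ m * (κ - β) := by
    rw [div_lt_iff₀ hd] at hm; exact hm.le
  have h3 : (n : ℝ) * (2 * κ) ≤ n * (m * (κ - β)) := by gcongr
  have h4 : (n : ℝ) * m * (κ - β) ≤ (n + k) * (κ - β) := by gcongr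
  push_cast
  nlinarith

section Stopping

variable {Ω : Type*} {mΩ : MeasurableSpace Ω} {μ : Measure Ω} [IsProbabilityMeasure μ]
  {ℱ : ℕ → MeasurableSpace Ω} {Z : ℕ → Ω → ℝ}

/-- The trajectories that start below `q` at time `n` and stay below `τ` for the next `k` steps. -/
def confined (Z : ℕ → Ω → ℝ) (τ q : ℝ) (n : ℕ) : ℕ → Set Ω
  | 0 => {ω | Z n ω ≤ q}
  | k + 1 => confined Z τ q n k ∩ {ω | Z (n + k + 1) ω ≤ τ}

theorem measurableSet_confined (hmono : ∀ t, ℱ t ≤ ℱ (t + 1))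
    (hZm : ∀ t, Measurable[ℱ t] (Z t)) (τ q : ℝ) (n k : ℕ) :
    MeasurableSet[ℱ (n + k)] (confined Z τ q n k) := by
  induction k with
  | zero => exact hZm n measurableSet_Iic
  | succ k ih =>
    exact (hmono _ _ ih).inter (hZm (n + k + 1) measurableSet_Iic)

theorem confined_subset {τ q : ℝ} (hq : q ≤ τ) (n k : ℕ) :
    confined Z τ q n k ⊆ {ω | Z (n + k) ω ≤ τ} := by
  cases k with
  | zero => exact fun ω hω => le_trans (show Z n ω ≤ q from hω) hq
  | succ k => exact fun ω hω => hω.2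

/-- Maximal inequality for the exit from `confined`. -/
theorem measure_diff_confined_le (hle : ∀ t, ℱ t ≤ mΩ) (hmono : ∀ t, ℱ t ≤ ℱ (t + 1))
    (hZm : ∀ t, Measurable[ℱ t] (Z t)) (hZi : ∀ t, Integrable (Z t) μ)
    (hZ0 : ∀ t, 0 ≤ᵐ[μ] Z t) (hmart : ∀ t, μ[Z (t + 1) | ℱ t] =ᵐ[μ] Z t)
    (τ q : ℝ) (n k : ℕ) :
    ∫⁻ ω in confined Z τ q n k, ENNReal.ofReal (Z (n + k) ω) ∂μ
      + ENNReal.ofReal τ * μ (confined Z τ q n 0 \ confined Z τ q n k) ≤ ENNReal.ofReal q := by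
  have hG : ∀ k, MeasurableSet (confined Z τ q n k) := fun k =>
    hle _ _ (measurableSet_confined hmono hZm τ q n k)
  induction k with
  | zero =>
    simp only [sdiff_self, Set.bot_eq_empty, measure_empty, mul_zero, add_zero]
    calc ∫⁻ ω in confined Z τ q n 0, ENNReal.ofReal (Z n ω) ∂μ
        ≤ ∫⁻ _ in confined Z τ q n 0, ENNReal.ofReal q ∂μ :=
          setLIntegral_mono measurable_const fun ω hω => ENNReal.ofReal_le_ofReal hω
      _ = ENNReal.ofReal q * μ (confined Z τ q n 0) := by simp
      _ ≤ ENNReal.ofReal q := mul_le_of_le_one_right' prob_le_one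
  | succ k ih =>
    refine le_trans ?_ ih
    set G := confined Z τ q n k with hGdef
    set E : Set Ω := {ω | Z (n + k + 1) ω ≤ τ} with hE
    have hEm : MeasurableSet E := hle _ _ (hZm (n + k + 1) measurableSet_Iic)
    have h1 : ENNReal.ofReal τ * μ (G \ E)
        ≤ ∫⁻ ω in G \ E, ENNReal.ofReal (Z (n + k + 1) ω) ∂μ := by
      rw [← setLIntegral_const]
      exact setLIntegral_mono ((hZm _).mono (hle _) le_rfl).ennreal_ofReal
        fun ω hω => ENNReal.ofReal_le_ofReal (not_le.1 hω.2).le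
    have h2 : ∫⁻ ω in G, ENNReal.ofReal (Z (n + k + 1) ω) ∂μ
        ≤ ∫⁻ ω in G, ENNReal.ofReal (Z (n + k) ω) ∂μ := by
      simpa using setLIntegral_mul_ofReal_le (hle (n + k))
        (measurableSet_confined hmono hZm τ q n k) (h := fun _ => 1) measurable_const
        (hZi (n + k + 1)) (hZ0 _) ((hmart (n + k)).le.mono fun ω h _ => h)
    have h3 : μ (confined Z τ q n 0 \ (G ∩ E))
        ≤ μ (confined Z τ q n 0 \ G) + μ (G \ E) := by
      refine (measure_mono ?_).trans (measure_union_le _ _)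
      intro ω hω
      by_cases h : ω ∈ G
      · exact Or.inr ⟨h, fun hE' => hω.2 ⟨h, hE'⟩⟩
      · exact Or.inl ⟨hω.1, h⟩
    have h4 := lintegral_inter_add_sdiff (μ := μ)
      (fun ω => ENNReal.ofReal (Z (n + k + 1) ω)) G hEm
    calc ∫⁻ ω in G ∩ E, ENNReal.ofReal (Z (n + k + 1) ω) ∂μ
          + ENNReal.ofReal τ * μ (confined Z τ q n 0 \ (G ∩ E))
        ≤ ∫⁻ ω in G ∩ E, ENNReal.ofReal (Z (n + k + 1) ω) ∂μ
          + ENNReal.ofReal τ * (μ (confined Z τ q n 0 \ G) + μ (G \ E)) := by gcongr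
      _ ≤ ∫⁻ ω in G ∩ E, ENNReal.ofReal (Z (n + k + 1) ω) ∂μ
          + (ENNReal.ofReal τ * μ (confined Z τ q n 0 \ G)
            + ∫⁻ ω in G \ E, ENNReal.ofReal (Z (n + k + 1) ω) ∂μ) := by
          rw [mul_add]; gcongr
      _ = ∫⁻ ω in G, ENNReal.ofReal (Z (n + k + 1) ω) ∂μ
          + ENNReal.ofReal τ * μ (confined Z τ q n 0 \ G) := by rw [← h4]; ring
      _ ≤ _ := by gcongr

/-- If `f (Z t)` contracts in mean as long as `Z` stays below `τ`, then a nonnegative martingale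
starting below `q` is unlikely to exit or to have `f (Z t)` large. -/
theorem measureReal_exit_or_large_le (hle : ∀ t, ℱ t ≤ mΩ) (hmono : ∀ t, ℱ t ≤ ℱ (t + 1))
    (hZm : ∀ t, Measurable[ℱ t] (Z t)) (hZi : ∀ t, Integrable (Z t) μ)
    (hZ0 : ∀ t, 0 ≤ᵐ[μ] Z t) (hmart : ∀ t, μ[Z (t + 1) | ℱ t] =ᵐ[μ] Z t)
    {f : ℝ → ℝ} (hf : Measurable f) {τ r : ℝ} (hτ : 0 < τ)
    (hf1 : ∀ z, 0 ≤ z → z ≤ τ → f z ≤ 1) (hr : 0 ≤ r)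
    (hstep : ∀ t, ∀ S, MeasurableSet[ℱ t] S → S ⊆ {ω | Z t ω ≤ τ} →
      ∫⁻ ω in S, ENNReal.ofReal (f (Z (t + 1) ω)) ∂μ
        ≤ ENNReal.ofReal r * ∫⁻ ω in S, ENNReal.ofReal (f (Z t ω)) ∂μ)
    (n k : ℕ) {q y : ℝ} (hq0 : 0 ≤ q) (hy : 0 < y) :
    μ.real {ω | Z n ω ≤ q ∧ (Z (n + k) ω ≤ τ → y ≤ f (Z (n + k) ω))} ≤ q / τ + r ^ k / y := by
  rcases lt_or_ge τ q with hq | hq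
  · have h1 : (1 : ℝ) ≤ q / τ := (one_le_div hτ).2 hq.le
    have h2 : 0 ≤ r ^ k / y := by positivity
    exact measureReal_le_one.trans (by linarith)
  have hGm : ∀ k, MeasurableSet[ℱ (n + k)] (confined Z τ q n k) :=
    measurableSet_confined hmono hZm τ q n
  have hpot : ∀ k, ∫⁻ ω in confined Z τ q n k, ENNReal.ofReal (f (Z (n + k) ω)) ∂μ
      ≤ ENNReal.ofReal (r ^ k) := by
    intro k
    induction k with
    | zero =>
      simp only [pow_zero, ENNReal.ofReal_one]
      calc ∫⁻ ω in confined Z τ q n 0, ENNReal.ofReal (f (Z n ω)) ∂μ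
          ≤ ∫⁻ _ in confined Z τ q n 0, 1 ∂μ := by
            refine setLIntegral_mono_ae' (hle _ _ (hGm 0)) ?_
            filter_upwards [hZ0 n] with ω h0 hω
            exact ENNReal.ofReal_le_one.2 (hf1 _ h0 (le_trans hω hq))
        _ ≤ 1 := by simpa using prob_le_one
    | succ k ih =>
      calc ∫⁻ ω in confined Z τ q n (k + 1), ENNReal.ofReal (f (Z (n + k + 1) ω)) ∂μ
          ≤ ∫⁻ ω in confined Z τ q n k, ENNReal.ofReal (f (Z (n + k + 1) ω)) ∂μ :=
            lintegral_mono_set Set.inter_subset_left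
        _ ≤ ENNReal.ofReal r * ∫⁻ ω in confined Z τ q n k, ENNReal.ofReal (f (Z (n + k) ω)) ∂μ :=
            hstep _ _ (hGm k) (confined_subset hq n k)
        _ ≤ ENNReal.ofReal r * ENNReal.ofReal (r ^ k) := by gcongr
        _ = ENNReal.ofReal (r ^ (k + 1)) := by rw [← ENNReal.ofReal_mul hr, pow_succ']
  have hexit : μ (confined Z τ q n 0 \ confined Z τ q n k) ≤ ENNReal.ofReal (q / τ) := by
    have := measure_diff_confined_le hle hmono hZm hZi hZ0 hmart τ q n k
    rw [ENNReal.ofReal_div_of_pos hτ, ENNReal.le_div_iff_mul_le (by simp [hτ]) (by simp), mul_comm]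
    exact le_trans le_add_self this
  have hlarge : μ (confined Z τ q n k ∩ {ω | y ≤ f (Z (n + k) ω)})
      ≤ ENNReal.ofReal (r ^ k / y) := by
    rw [ENNReal.ofReal_div_of_pos hy, ENNReal.le_div_iff_mul_le (by simp [hy]) (by simp), mul_comm,
      ← setLIntegral_const]
    have hm : Measurable fun ω => ENNReal.ofReal (f (Z (n + k) ω)) :=
      (hf.comp ((hZm _).mono (hle _) le_rfl)).ennreal_ofReal
    exact (setLIntegral_mono hm fun ω hω => ENNReal.ofReal_le_ofReal hω.2).trans
      ((lintegral_mono_set Set.inter_subset_left).trans (hpot k))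
  refine ENNReal.toReal_le_of_le_ofReal (by positivity) ?_
  rw [ENNReal.ofReal_add (by positivity) (by positivity)]
  refine (measure_mono ?_).trans ((measure_union_le _ _).trans (add_le_add hexit hlarge))
  rintro ω ⟨h1, h2⟩
  by_cases h : ω ∈ confined Z τ q n k
  · exact Or.inr ⟨h, h2 (confined_subset hq n k h)⟩
  · exact Or.inl ⟨h1, h⟩

end Stopping

section Ends

variable {Ω : Type*} {mΩ : MeasurableSpace Ω} {μ : Measure Ω} [IsProbabilityMeasure μ]
  {ℱ : ℕ → MeasurableSpace Ω} {Z : ℕ → Ω → ℝ}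

/-- Strong suction at zero: a nonnegative martingale that is small at time `n` is doubly
exponentially small a constant factor of time later. -/
theorem exists_measureReal_low_le (hle : ∀ t, ℱ t ≤ mΩ) (hmono : ∀ t, ℱ t ≤ ℱ (t + 1))
    (hZm : ∀ t, Measurable[ℱ t] (Z t)) (hZi : ∀ t, Integrable (Z t) μ)
    (hZ0 : ∀ t, 0 ≤ᵐ[μ] Z t) (hmart : ∀ t, μ[Z (t + 1) | ℱ t] =ᵐ[μ] Z t)
    {η b Λ : ℝ} (hη1 : η ≤ 1) (hb : 1 < b) (hΛ0 : 0 < Λ)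
    (hΛ : Λ < η * Real.logb 2 b)
    (hstrong : ∃ τ : ℝ, 0 < τ ∧ ∀ j : ℕ, ∀ᵐ ω ∂μ, Z j ω ≤ τ →
      η ≤ (μ[Set.indicator {ω' | Z (j + 1) ω' ≤ Z j ω' ^ b} (fun _ => (1 : ℝ)) | ℱ j]) ω) :
    ∃ τ : ℝ, 0 < τ ∧ ∃ m : ℕ, 0 < m ∧ ∃ σ : ℝ, 0 < σ ∧ σ < 1 ∧
      ∀ n k : ℕ, n * m ≤ n + k → ∀ q : ℝ, 0 ≤ q →
        μ.real {ω | Z n ω ≤ q ∧ (2 : ℝ) ^ (-((2 : ℝ) ^ (Λ * ((n + k : ℕ) : ℝ)))) < Z (n + k) ω}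
          ≤ q / τ + σ ^ (n + k) := by
  obtain ⟨τ₀, hτ₀, hstrong⟩ := hstrong
  have hln2 : 0 < Real.log 2 := Real.log_pos (by norm_num)
  have hB : 0 < Real.log b := Real.log_pos hb
  have hgap : Λ * Real.log 2 < η * Real.log b := by
    rw [Real.logb, ← mul_div_assoc, lt_div_iff₀ hln2] at hΛ
    exact hΛ
  set A := Λ * Real.log 2 with hA
  have hA0 : 0 < A := by positivity
  have hη0 : 0 < η := by
    by_contra! h
    nlinarith
  obtain ⟨s, hs0, hs1, hs⟩ : ∃ s : ℝ, 0 < s ∧ s ≤ 1 ∧ A * s < η * (1 - b ^ (-s)) := by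
    set s := min 1 ((η * Real.log b - A) / (2 * (A * Real.log b))) with hsdef
    have hs0 : 0 < s := lt_min one_pos (div_pos (by linarith) (by positivity))
    refine ⟨s, hs0, min_le_left _ _, ?_⟩
    have h1 : s * (2 * (A * Real.log b)) ≤ η * Real.log b - A := by
      rw [← le_div_iff₀ (by positivity)]
      exact min_le_right _ _
    have h2 : b ^ (-s) ≤ (1 + s * Real.log b)⁻¹ := by
      rw [Real.rpow_neg (by linarith), Real.rpow_def_of_pos (by linarith)]
      apply inv_anti₀ (by positivity)
      linarith [Real.add_one_le_exp (Real.log b * s)]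
    have h3 : A * s < η * (1 - (1 + s * Real.log b)⁻¹) := by
      have hp : 0 < 1 + s * Real.log b := by positivity
      have : 1 - (1 + s * Real.log b)⁻¹ = s * Real.log b / (1 + s * Real.log b) := by
        field_simp
        ring
      rw [this, ← mul_div_assoc, lt_div_iff₀ hp]
      have : 0 < s * (A * Real.log b) := by positivity
      nlinarith
    nlinarith
  set p := b ^ (-s) with hp
  have hp0 : 0 < p := Real.rpow_pos_of_pos (by linarith) _
  have hp1 : p ≤ 1 := Real.rpow_le_one_of_one_le_of_nonpos hb.le (by linarith)
  set δ := (η * (1 - p) - A * s) / 2 with hδ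
  have hδ0 : 0 < δ := by rw [hδ]; linarith
  set τ := min τ₀ (Real.exp (-(1 + 1 / δ))) with hτdef
  have hτ0 : 0 < τ := lt_min hτ₀ (Real.exp_pos _)
  have hLτ : 1 + 1 / δ ≤ -Real.log τ := by
    have := Real.log_le_log hτ0 (min_le_right τ₀ (Real.exp (-(1 + 1 / δ))))
    rw [Real.log_exp] at this
    linarith
  have hδp : 0 < 1 / δ := by positivity
  have hL0 : 0 < -Real.log τ := by linarith
  have hτ1 : τ < 1 := (Real.log_neg_iff hτ0).1 (by linarith)
  have hδL : (-Real.log τ)⁻¹ ≤ δ := by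
    rw [inv_le_comm₀ hL0 hδ0, ← one_div]
    linarith
  obtain ⟨m, hm, σ, hσ0, hσ1, hσ⟩ := exists_exp_mul_exp_le_pow (κ := η * (1 - p) - δ) (β := A * s)
    (by positivity) (by rw [hδ]; linarith)
  refine ⟨τ, hτ0, m, hm, σ, hσ0, hσ1, fun n k hnk q hq => ?_⟩
  set f : ℝ → ℝ := (Set.Iic τ).indicator fun z => (-Real.log z) ^ (-s) with hf
  have hfm : Measurable f :=
    (Real.measurable_log.neg.pow_const _).indicator measurableSet_Iic
  have hf1 : ∀ z, 0 ≤ z → z ≤ τ → f z ≤ 1 := by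
    intro z hz hzτ
    simp only [hf, Set.indicator_of_mem (Set.mem_Iic.2 hzτ)]
    rcases hz.eq_or_lt with rfl | hz
    · simp [Real.zero_rpow, hs0.ne']
    · exact Real.rpow_le_one_of_one_le_of_nonpos
        (by linarith [Real.log_le_log hz hzτ]) (by linarith)
  have hstep : ∀ t, ∀ S, MeasurableSet[ℱ t] S → S ⊆ {ω | Z t ω ≤ τ} →
      ∫⁻ ω in S, ENNReal.ofReal (f (Z (t + 1) ω)) ∂μ
        ≤ ENNReal.ofReal (Real.exp (-(η * (1 - p) - δ)))
          * ∫⁻ ω in S, ENNReal.ofReal (f (Z t ω)) ∂μ := by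
    intro t S hS hSτ
    have hZt : Measurable (Z t) := (hZm t).mono (hle t) le_rfl
    have hZt' : Measurable (Z (t + 1)) := (hZm (t + 1)).mono (hle (t + 1)) le_rfl
    refine (setLIntegral_drift_le (hle t) hS (F := fun ω => f (Z (t + 1) ω))
      (f := fun ω => f (Z t ω)) (g := Z t) (Z := Z (t + 1))
      (B := {ω' | Z (t + 1) ω' ≤ Z t ω' ^ b})
      (measurableSet_le hZt' (hZt.pow_const b)) (hfm.comp (hZm t)) (hZm t)
      ?_ (hZ0 t) (hZi _) (hZ0 _) (a := p) (b := 1 - p) (κ := η) (ν := 1)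
      (δ := (-Real.log τ)⁻¹) hp0.le (by linarith) hη1 zero_le_one (by positivity)
      ?_ ?_ ?_ ?_).trans ?_
    · filter_upwards [hZ0 t] with ω h0 hω
      have hωτ : Z t ω ≤ τ := hSτ hω
      simp only [hf, Set.indicator_of_mem (Set.mem_Iic.2 hωτ)]
      exact Real.rpow_nonneg (by linarith [Real.log_nonpos h0 (hωτ.trans hτ1.le)]) _
    · filter_upwards [hstrong t] with ω h hω
      exact h (le_trans (hSτ hω) (min_le_left _ _))
    · filter_upwards [hmart t] with ω h hω
      simp [h]
    · filter_upwards [hZ0 (t + 1)] with ω h0 hω hpos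
      have hωτ : Z t ω ≤ τ := hSτ hω
      have key : ∀ y, 0 ≤ y → y ≤ τ → ∀ i : ℝ, (i = 0 ∨ i = 1 ∧ y ≤ Z t ω ^ b) →
        (-Real.log y) ^ (-s) ≤ (-Real.log (Z t ω)) ^ (-s) *
          (p + (1 - p) * (1 - i) + (-Real.log τ)⁻¹ * (y / Z t ω)) := fun y hy hyτ i hi =>
        Real.neg_log_rpow_le_mul hpos hωτ hy hyτ hτ1 hs0 hs1 hb.le hi
      have hi : ({ω' | Z (t + 1) ω' ≤ Z t ω' ^ b}.indicator (fun _ => (1 : ℝ)) ω) = 0 ∨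
          ({ω' | Z (t + 1) ω' ≤ Z t ω' ^ b}.indicator (fun _ => (1 : ℝ)) ω) = 1 ∧
          Z (t + 1) ω ≤ Z t ω ^ b := by
        by_cases h : Z (t + 1) ω ≤ Z t ω ^ b
        · right; exact ⟨Set.indicator_of_mem (s := {ω' | Z (t + 1) ω' ≤ Z t ω' ^ b}) h _, h⟩
        · left; exact Set.indicator_of_notMem (s := {ω' | Z (t + 1) ω' ≤ Z t ω' ^ b}) h _
      simp only [hf, Set.indicator_of_mem (Set.mem_Iic.2 hωτ)]
      by_cases hy : Z (t + 1) ω ≤ τ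
      · rw [Set.indicator_of_mem (Set.mem_Iic.2 hy)]
        exact key _ h0 hy _ hi
      · rw [Set.indicator_of_notMem (by simpa using hy)]
        refine mul_nonneg (Real.rpow_nonneg
          (by linarith [Real.log_nonpos hpos.le (hωτ.trans hτ1.le)]) _) ?_
        have : (0 : ℝ) ≤ 1 -
            ({ω' | Z (t + 1) ω' ≤ Z t ω' ^ b}.indicator (fun _ => (1 : ℝ)) ω) := by
          rcases hi with h | ⟨h, -⟩ <;> simp [h]
        have h0' : (0 : ℝ) ≤ Z (t + 1) ω := h0
        have h1p : 0 ≤ 1 - p := by linarith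
        positivity
    · filter_upwards with ω _ h
      simp [hf, h, Real.zero_rpow, hs0.ne', hτ0.le]
    · gcongr
      have := Real.add_one_le_exp (-(η * (1 - p) - δ))
      linarith
  have main := measureReal_exit_or_large_le hle hmono hZm hZi hZ0 hmart hfm hτ0 hf1
    (Real.exp_pos _).le hstep n k (q := q) (y := Real.exp (-(A * s * ((n + k : ℕ) : ℝ)))) hq
    (Real.exp_pos _)
  rw [Real.exp_neg (A * s * ((n + k : ℕ) : ℝ)), div_inv_eq_mul] at main
  refine le_trans (measureReal_mono ?_) (main.trans (by gcongr; exact hσ n k hnk))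
  rintro ω ⟨h1, h2⟩
  refine ⟨h1, fun h3 => ?_⟩
  set t : ℝ := ((n + k : ℕ) : ℝ)
  have hpos : 0 < Z (n + k) ω := lt_trans (by positivity) h2
  have h4 := Real.log_lt_log (by positivity) h2
  rw [Real.log_rpow (by norm_num)] at h4
  have h5 : -Real.log (Z (n + k) ω) ≤ (2 : ℝ) ^ (Λ * t) := by
    have h6 : Real.log 2 ≤ 1 := by linarith [Real.log_two_lt_d9]
    have h7 : 0 < (2 : ℝ) ^ (Λ * t) := by positivity
    nlinarith
  have h6 : 0 < -Real.log (Z (n + k) ω) := by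
    linarith [Real.log_neg hpos (h3.trans_lt hτ1)]
  simp only [hf, Set.indicator_of_mem (Set.mem_Iic.2 h3)]
  rw [← Real.exp_neg]
  refine le_trans (le_of_eq ?_) (Real.rpow_le_rpow_of_nonpos h6 h5 (by linarith))
  rw [← Real.rpow_mul (by norm_num), Real.rpow_def_of_pos (by norm_num), hA]
  congr 1
  ring

/-- Suction at zero with arbitrary rates: a nonnegative martingale that is small at time `n` is
exponentially small, with any prescribed base, a constant factor of time later. -/
theorem exists_measureReal_suction_le (hle : ∀ t, ℱ t ≤ mΩ) (hmono : ∀ t, ℱ t ≤ ℱ (t + 1))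
    (hZm : ∀ t, Measurable[ℱ t] (Z t)) (hZi : ∀ t, Integrable (Z t) μ)
    (hZ0 : ∀ t, 0 ≤ᵐ[μ] Z t) (hmart : ∀ t, μ[Z (t + 1) | ℱ t] =ᵐ[μ] Z t)
    {α γ : ℝ} (hα0 : 0 < α) (hα1 : α ≤ 1) (hγ0 : 0 < γ) (hγ1 : γ < 1)
    (hsuction : ∀ c : ℝ, 0 < c → ∃ τ : ℝ, 0 < τ ∧ ∀ j : ℕ, ∀ᵐ ω ∂μ, Z j ω ≤ τ →
      α ≤ (μ[Set.indicator {ω' | Z (j + 1) ω' ≤ Z j ω' / c} (fun _ => (1 : ℝ)) | ℱ j]) ω) :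
    ∃ τ : ℝ, 0 < τ ∧ ∃ m : ℕ, 0 < m ∧ ∃ σ : ℝ, 0 < σ ∧ σ < 1 ∧
      ∀ n k : ℕ, n * m ≤ n + k → ∀ q : ℝ, 0 ≤ q →
        μ.real {ω | Z n ω ≤ q ∧ γ ^ (n + k) < Z (n + k) ω} ≤ q / τ + σ ^ (n + k) := by
  set l := -Real.log γ with hl
  have hl0 : 0 < l := by linarith [Real.log_neg hγ0 hγ1]
  set s := α / (8 * (1 + l)) with hs
  have hs0 : 0 < s := by positivity
  have hsl : s * (1 + l) = α / 8 := by
    rw [hs]; field_simp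
  have hsl0 : 0 < s * l := by positivity
  have hs8 : s ≤ α / 8 := by linarith
  have hs1 : s ≤ 1 := by linarith
  set C : ℝ := 2 ^ s⁻¹ with hC
  have hC1 : 1 ≤ C := Real.one_le_rpow (by norm_num) (by positivity)
  have hCs : C ^ (-s) = 1 / 2 := by
    rw [hC, ← Real.rpow_mul (by norm_num)]
    have : s⁻¹ * -s = -1 := by field_simp
    rw [this, Real.rpow_neg_one]
    norm_num
  obtain ⟨τ₀, hτ₀, hsuction⟩ := hsuction C (by linarith)
  set τ := min τ₀ 1 with hτdef
  have hτ0 : 0 < τ := lt_min hτ₀ one_pos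
  obtain ⟨m, hm, σ, hσ0, hσ1, hσ⟩ := exists_exp_mul_exp_le_pow (κ := α / 2 - s) (β := s * l)
    (by positivity) (by linarith)
  refine ⟨τ, hτ0, m, hm, σ, hσ0, hσ1, fun n k hnk q hq => ?_⟩
  set f : ℝ → ℝ := fun z => z ^ s with hf
  have hfm : Measurable f := measurable_id.pow_const s
  have hstep : ∀ t, ∀ S, MeasurableSet[ℱ t] S → S ⊆ {ω | Z t ω ≤ τ} →
      ∫⁻ ω in S, ENNReal.ofReal (f (Z (t + 1) ω)) ∂μ
        ≤ ENNReal.ofReal (Real.exp (-(α / 2 - s)))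
          * ∫⁻ ω in S, ENNReal.ofReal (f (Z t ω)) ∂μ := by
    intro t S hS hSτ
    have hZt : Measurable (Z t) := (hZm t).mono (hle t) le_rfl
    have hZt' : Measurable (Z (t + 1)) := (hZm (t + 1)).mono (hle (t + 1)) le_rfl
    refine (setLIntegral_drift_le (hle t) hS (F := fun ω => f (Z (t + 1) ω))
      (f := fun ω => f (Z t ω)) (g := Z t) (Z := Z (t + 1))
      (B := {ω' | Z (t + 1) ω' ≤ Z t ω' / C})
      (measurableSet_le hZt' (hZt.div_const C)) (hfm.comp (hZm t)) (hZm t)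
      ?_ (hZ0 t) (hZi _) (hZ0 _) (a := C ^ (-s)) (b := 1 - C ^ (-s)) (κ := α) (ν := 1)
      (δ := s) (by rw [hCs]; norm_num) (by rw [hCs]; norm_num) hα1 zero_le_one hs0.le
      ?_ ?_ ?_ ?_).trans ?_
    · filter_upwards [hZ0 t] with ω h0 _
      exact Real.rpow_nonneg h0 s
    · filter_upwards [hsuction t] with ω h hω
      exact h (le_trans (hSτ hω) (min_le_left _ _))
    · filter_upwards [hmart t] with ω h hω
      simp [h]
    · filter_upwards [hZ0 (t + 1)] with ω h0 hω hpos
      refine Real.rpow_le_mul_of_suction h0 hpos hs0 hs1 hC1 ?_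
      by_cases h : Z (t + 1) ω ≤ Z t ω / C
      · right; exact ⟨Set.indicator_of_mem (s := {ω' | Z (t + 1) ω' ≤ Z t ω' / C}) h _, h⟩
      · left; exact Set.indicator_of_notMem (s := {ω' | Z (t + 1) ω' ≤ Z t ω' / C}) h _
    · filter_upwards with ω _ h
      simp [hf, h, Real.zero_rpow, hs0.ne']
    · gcongr
      have := Real.add_one_le_exp (-(α / 2 - s))
      rw [hCs]
      linarith
  have main := measureReal_exit_or_large_le hle hmono hZm hZi hZ0 hmart hfm hτ0
    (fun z hz hzτ => Real.rpow_le_one hz (hzτ.trans (min_le_right _ _)) hs0.le)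
    (Real.exp_pos _).le hstep n k (q := q) (y := Real.exp (-(s * l * ((n + k : ℕ) : ℝ)))) hq
    (Real.exp_pos _)
  rw [Real.exp_neg (s * l * ((n + k : ℕ) : ℝ)), div_inv_eq_mul] at main
  refine le_trans (measureReal_mono ?_) (main.trans (by gcongr; exact hσ n k hnk))
  rintro ω ⟨h1, h2⟩
  refine ⟨h1, fun _ => ?_⟩
  refine le_trans (le_of_eq ?_) (Real.rpow_le_rpow (by positivity) h2.le hs0.le)
  rw [← Real.exp_neg, ← Real.rpow_natCast, ← Real.rpow_mul hγ0.le, Real.rpow_def_of_pos hγ0, hl]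
  congr 1
  ring

end Ends

theorem condExp_mul_one_sub_eq {Ω : Type*} {m m0 : MeasurableSpace Ω} {μ : Measure Ω}
    [IsFiniteMeasure μ] (hm : m ≤ m0) {X Y : Ω → ℝ}
    (hX : Measurable[m] X) (hY : Measurable Y) (hX01 : ∀ᵐ ω ∂μ, X ω ∈ Set.Icc (0 : ℝ) 1)
    (hY01 : ∀ᵐ ω ∂μ, Y ω ∈ Set.Icc (0 : ℝ) 1) (hXY : μ[Y | m] =ᵐ[μ] X) :
    μ[fun ω => Y ω * (1 - Y ω) | m]
      =ᵐ[μ] fun ω => X ω * (1 - X ω) - (μ[fun ω => (Y ω - X ω) ^ 2 | m]) ω := by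
  have hX' : Measurable X := hX.mono hm le_rfl
  have hYi : Integrable Y μ := Integrable.of_mem_Icc 0 1 hY.aemeasurable hY01
  have hXi : Integrable X μ := Integrable.of_mem_Icc 0 1 hX'.aemeasurable hX01
  have hwi : Integrable (fun ω => X ω * (1 - X ω)) μ := by
    refine Integrable.of_mem_Icc 0 1 (hX'.mul (measurable_const.sub hX')).aemeasurable ?_
    filter_upwards [hX01] with ω h
    exact ⟨mul_nonneg h.1 (by linarith [h.2]), by nlinarith [h.1, h.2]⟩
  have hdi : Integrable (fun ω => (Y ω - X ω) ^ 2) μ := by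
    refine Integrable.of_mem_Icc 0 1 ((hY.sub hX').pow_const 2).aemeasurable ?_
    filter_upwards [hX01, hY01] with ω h h'
    exact ⟨sq_nonneg _, by nlinarith [h.1, h.2, h'.1, h'.2]⟩
  have hDi : Integrable (Y - X) μ := hYi.sub hXi
  have hpi : Integrable ((fun ω => 1 - 2 * X ω) * (Y - X)) μ := by
    refine Integrable.of_mem_Icc (-1) 1
      ((measurable_const.sub (hX'.const_mul 2)).mul (hY.sub hX')).aemeasurable ?_
    filter_upwards [hX01, hY01] with ω h h'
    simp only [Pi.mul_apply, Pi.sub_apply]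
    exact ⟨by nlinarith [h.1, h.2, h'.1, h'.2], by nlinarith [h.1, h.2, h'.1, h'.2]⟩
  have e : (fun ω => Y ω * (1 - Y ω)) = (fun ω => X ω * (1 - X ω))
      + (fun ω => 1 - 2 * X ω) * (Y - X) - fun ω => (Y ω - X ω) ^ 2 := by
    ext ω
    simp only [Pi.add_apply, Pi.sub_apply, Pi.mul_apply]
    ring
  have h1 := condExp_sub (hwi.add hpi) hdi m
  have h2 := condExp_add hwi hpi m
  have h3 : μ[(fun ω => 1 - 2 * X ω) * (Y - X) | m]
      =ᵐ[μ] (fun ω => 1 - 2 * X ω) * μ[Y - X | m] :=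
    condExp_mul_of_stronglyMeasurable_left
      (measurable_const.sub (hX.const_mul 2)).stronglyMeasurable hpi hDi
  have h4 := condExp_sub hYi hXi m
  have h5 : μ[X | m] = X := condExp_of_stronglyMeasurable hm hX.stronglyMeasurable hXi
  have h6 : μ[fun ω => X ω * (1 - X ω) | m] = fun ω => X ω * (1 - X ω) :=
    condExp_of_stronglyMeasurable hm
      (hX.mul (measurable_const.sub hX)).stronglyMeasurable hwi
  rw [e]
  filter_upwards [h1, h2, h3, h4, hXY] with ω h1 h2 h3 h4 h7
  rw [h1, Pi.sub_apply, h2, Pi.add_apply, h3, Pi.mul_apply, h4, Pi.sub_apply, h5, h6, h7]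
  ring

section Middle

variable {Ω : Type*} {mΩ : MeasurableSpace Ω} {μ : Measure Ω} [IsProbabilityMeasure μ]
  {ℱ : ℕ → MeasurableSpace Ω} {X : ℕ → Ω → ℝ}

/-- Local polarization makes `X n * (1 - X n)` exponentially small outside an event of
exponentially small probability. -/
theorem exists_measureReal_mul_one_sub_le (hle : ∀ t, ℱ t ≤ mΩ)
    (hXm : ∀ t, Measurable[ℱ t] (X t)) (hX01 : ∀ t, ∀ᵐ ω ∂μ, X t ω ∈ Set.Icc (0 : ℝ) 1)
    (hmart : ∀ t, μ[X (t + 1) | ℱ t] =ᵐ[μ] X t)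
    (hvar : ∀ τ : ℝ, 0 < τ → ∃ θ : ℝ, 0 < θ ∧ ∀ j : ℕ, ∀ᵐ ω ∂μ,
      X j ω ∈ Set.Ioo τ (1 - τ) →
      θ ≤ (μ[fun ω' => (X (j + 1) ω' - X j ω') ^ 2 | ℱ j]) ω)
    {α : ℝ} (hα0 : 0 < α) (hα1 : α ≤ 1)
    (hlow : ∀ c : ℝ, 0 < c → ∃ τ : ℝ, 0 < τ ∧ ∀ j : ℕ, ∀ᵐ ω ∂μ, X j ω ≤ τ →
      α ≤ (μ[Set.indicator {ω' | X (j + 1) ω' ≤ X j ω' / c} (fun _ => (1 : ℝ)) | ℱ j]) ω)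
    (hhigh : ∀ c : ℝ, 0 < c → ∃ τ : ℝ, 0 < τ ∧ ∀ j : ℕ, ∀ᵐ ω ∂μ, 1 - X j ω ≤ τ →
      α ≤ (μ[Set.indicator {ω' | 1 - X (j + 1) ω' ≤ (1 - X j ω') / c}
        (fun _ => (1 : ℝ)) | ℱ j]) ω) :
    ∃ ρ : ℝ, 0 < ρ ∧ ρ < 1 ∧ ∀ n : ℕ,
      μ.real {ω | ρ ^ n < X n ω * (1 - X n ω)} ≤ ρ ^ n := by
  set s := α / 4 with hs
  have hs0 : 0 < s := by positivity
  have hs1 : s ≤ 1 := by linarith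
  set C : ℝ := 2 ^ s⁻¹ with hC
  have hC1 : 1 ≤ C := Real.one_le_rpow (by norm_num) (by positivity)
  have hC0 : 0 < C := by linarith
  have hCs : C ^ (-s) = 1 / 2 := by
    rw [hC, ← Real.rpow_mul (by norm_num)]
    have : s⁻¹ * -s = -1 := by field_simp
    rw [this, Real.rpow_neg_one]
    norm_num
  obtain ⟨τ₁, hτ₁, hlow⟩ := hlow (2 * C) (by linarith)
  obtain ⟨τ₂, hτ₂, hhigh⟩ := hhigh (2 * C) (by linarith)
  set τ := min (1 / 2) (min τ₁ τ₂) with hτ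
  have hτ0 : 0 < τ := lt_min (by norm_num) (lt_min hτ₁ hτ₂)
  have hτh : τ ≤ 1 / 2 := min_le_left _ _
  have hττ₁ : τ ≤ τ₁ := (min_le_right _ _).trans (min_le_left _ _)
  have hττ₂ : τ ≤ τ₂ := (min_le_right _ _).trans (min_le_right _ _)
  obtain ⟨θ₀, hθ₀, hvar⟩ := hvar τ hτ0
  set θ := min θ₀ (1 / 8) with hθ
  have hθ0 : 0 < θ := lt_min hθ₀ (by norm_num)
  have hθ8 : θ ≤ 1 / 8 := min_le_right _ _
  have hsθ : 0 < s * θ := by positivity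
  set r := max (1 - α / 4) (1 - 4 * s * θ) with hr
  have hr1 : r < 1 := max_lt (by linarith) (by linarith)
  have hr0 : 0 < r := lt_max_of_lt_left (by linarith)
  set W : ℕ → Ω → ℝ := fun t ω => X t ω * (1 - X t ω) with hW
  have hWm : ∀ t, Measurable[ℱ t] (W t) := fun t => (hXm t).mul (measurable_const.sub (hXm t))
  have hX' : ∀ t, Measurable (X t) := fun t => (hXm t).mono (hle t) le_rfl
  have hW01 : ∀ t, ∀ᵐ ω ∂μ, W t ω ∈ Set.Icc (0 : ℝ) (1 / 4) := by
    intro t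
    filter_upwards [hX01 t] with ω h
    exact ⟨mul_nonneg h.1 (by linarith [h.2]), by nlinarith [sq_nonneg (X t ω - 1 / 2)]⟩
  have hW0 : ∀ t, ∀ᵐ ω ∂μ, 0 ≤ W t ω := fun t => (hW01 t).mono fun ω h => h.1
  have hWi : ∀ t, Integrable (W t) μ := fun t =>
    Integrable.of_mem_Icc 0 (1 / 4) ((hWm t).mono (hle t) le_rfl).aemeasurable (hW01 t)
  have hWc : ∀ t, μ[W (t + 1) | ℱ t]
      =ᵐ[μ] fun ω => W t ω - (μ[fun ω => (X (t + 1) ω - X t ω) ^ 2 | ℱ t]) ω := fun t =>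
    condExp_mul_one_sub_eq (hle t) (hXm t) (hX' _) (hX01 t) (hX01 _) (hmart t)
  have hWle : ∀ t, ∀ᵐ ω ∂μ, (μ[W (t + 1) | ℱ t]) ω ≤ 1 * W t ω := by
    intro t
    have h0 : 0 ≤ᵐ[μ] μ[fun ω => (X (t + 1) ω - X t ω) ^ 2 | ℱ t] :=
      condExp_nonneg (.of_forall fun ω => sq_nonneg _)
    filter_upwards [hWc t, h0] with ω h h0
    simp only [Pi.zero_apply] at h0
    linarith
  have hends : ∀ t, ∀ S B : Set Ω, MeasurableSet[ℱ t] S → MeasurableSet B →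
      (∀ᵐ ω ∂μ, ω ∈ S → α ≤ (μ[B.indicator (fun _ => (1 : ℝ)) | ℱ t]) ω) →
      (∀ᵐ ω ∂μ, ω ∈ S → ω ∈ B → W (t + 1) ω ≤ W t ω / C) →
      ∫⁻ ω in S, ENNReal.ofReal (W (t + 1) ω ^ s) ∂μ
        ≤ ENNReal.ofReal r * ∫⁻ ω in S, ENNReal.ofReal (W t ω ^ s) ∂μ := by
    intro t S B hS hB hα hWC
    refine (setLIntegral_drift_le (hle t) hS (F := fun ω => W (t + 1) ω ^ s)
      (f := fun ω => W t ω ^ s) (g := W t) (Z := W (t + 1)) hB ((hWm t).pow_const s) (hWm t)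
      ((hW0 t).mono fun ω h _ => Real.rpow_nonneg h s) (hW0 t) (hWi _) (hW0 _)
      (a := C ^ (-s)) (b := 1 - C ^ (-s)) (κ := α) (ν := 1) (δ := s)
      (by rw [hCs]; norm_num) (by rw [hCs]; norm_num) hα1 zero_le_one hs0.le hα
      ((hWle t).mono fun ω h _ => h) ?_ ?_).trans ?_
    · filter_upwards [hW0 (t + 1), hWC] with ω h0 hc hω hpos
      refine Real.rpow_le_mul_of_suction h0 hpos hs0 hs1 hC1 ?_
      by_cases h : ω ∈ B
      · exact Or.inr ⟨Set.indicator_of_mem h _, hc hω h⟩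
      · exact Or.inl (Set.indicator_of_notMem h _)
    · filter_upwards with ω _ h
      simp [h, Real.zero_rpow, hs0.ne']
    · gcongr
      refine le_trans ?_ (le_max_left _ _)
      rw [hCs]
      linarith
  have hstep : ∀ t, ∫⁻ ω, ENNReal.ofReal (W (t + 1) ω ^ s) ∂μ
      ≤ ENNReal.ofReal r * ∫⁻ ω, ENNReal.ofReal (W t ω ^ s) ∂μ := by
    intro t
    have hS₁ : MeasurableSet[ℱ t] {ω | X t ω ≤ τ} := hXm t measurableSet_Iic
    have hS₂ : MeasurableSet[ℱ t] {ω | 1 - X t ω ≤ τ} :=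
      (measurable_const.sub (hXm t)) measurableSet_Iic
    set S₁ := {ω | X t ω ≤ τ} with hS₁def
    set S₂ := {ω | 1 - X t ω ≤ τ} with hS₂def
    have low := hends t S₁ {ω' | X (t + 1) ω' ≤ X t ω' / (2 * C)} hS₁
      (measurableSet_le (hX' _) ((hX' t).div_const _))
      ((hlow t).mono fun ω h hω => h (le_trans hω hττ₁)) (by
        filter_upwards [hX01 t, hX01 (t + 1)] with ω h h' hω hB
        have hω : X t ω ≤ τ := hω
        have hB : X (t + 1) ω ≤ X t ω / (2 * C) := hB
        rw [le_div_iff₀ (by linarith)] at hB ⊢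
        have h1 : W (t + 1) ω ≤ X (t + 1) ω := by simp only [hW]; nlinarith [h'.1]
        have h2 : X t ω * (1 / 2) ≤ W t ω :=
          mul_le_mul_of_nonneg_left (by linarith) h.1
        nlinarith)
    have high := hends t (S₁ᶜ ∩ S₂) {ω' | 1 - X (t + 1) ω' ≤ (1 - X t ω') / (2 * C)}
      (hS₁.compl.inter hS₂)
      (measurableSet_le (measurable_const.sub (hX' _)) ((measurable_const.sub (hX' t)).div_const _))
      ((hhigh t).mono fun ω h hω => h (le_trans hω.2 hττ₂)) (by
        filter_upwards [hX01 t, hX01 (t + 1)] with ω h h' hω hB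
        have hω : 1 - X t ω ≤ τ := hω.2
        have hB : 1 - X (t + 1) ω ≤ (1 - X t ω) / (2 * C) := hB
        rw [le_div_iff₀ (by linarith)] at hB ⊢
        have h1 : W (t + 1) ω ≤ 1 - X (t + 1) ω := by
          simp only [hW]; nlinarith [h'.1, h'.2]
        have h2 : (1 / 2) * (1 - X t ω) ≤ W t ω :=
          mul_le_mul_of_nonneg_right (by linarith) (by linarith [h.2])
        nlinarith)
    have mid : ∫⁻ ω in S₁ᶜ \ S₂, ENNReal.ofReal (W (t + 1) ω ^ s) ∂μ
        ≤ ENNReal.ofReal r * ∫⁻ ω in S₁ᶜ \ S₂, ENNReal.ofReal (W t ω ^ s) ∂μ := by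
      refine (setLIntegral_drift_le (hle t) (hS₁.compl.diff hS₂)
        (F := fun ω => W (t + 1) ω ^ s) (f := fun ω => W t ω ^ s) (g := W t) (Z := W (t + 1))
        (B := ∅) .empty ((hWm t).pow_const s) (hWm t)
        ((hW0 t).mono fun ω h _ => Real.rpow_nonneg h s) (hW0 t) (hWi _) (hW0 _)
        (a := 1 - s) (b := 0) (κ := 0) (ν := 1 - 4 * θ) (δ := s)
        (by linarith) le_rfl zero_le_one (by linarith) hs0.le ?_ ?_ ?_ ?_).trans ?_
      · exact (condExp_nonneg (.of_forall fun ω => by simp)).mono fun ω h _ => h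
      · filter_upwards [hWc t, hvar t, hW01 t] with ω h hv hw hω
        have h1 : X t ω ∈ Set.Ioo τ (1 - τ) :=
          ⟨not_le.1 hω.1, by linarith [not_le.1 (show ¬ 1 - X t ω ≤ τ from hω.2)]⟩
        have h2 := hv h1
        have h3 : θ ≤ θ₀ := min_le_left _ _
        rw [h]
        nlinarith [hw.1, hw.2]
      · filter_upwards [hW0 t, hW0 (t + 1)] with ω h0 h1 hω hpos
        have e : W (t + 1) ω ^ s = W t ω ^ s * (W (t + 1) ω / W t ω) ^ s := by
          rw [Real.div_rpow h1 h0]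
          field_simp
        rw [e]
        gcongr
        have := Real.rpow_le_one_sub_add_mul (r := W (t + 1) ω / W t ω) (by positivity)
          hs0.le hs1
        linarith
      · filter_upwards with ω _ h
        simp [h, Real.zero_rpow, hs0.ne']
      · gcongr
        refine le_trans ?_ (le_max_right _ _)
        linarith
    have split : ∀ G : Ω → ℝ≥0∞, ∫⁻ ω, G ω ∂μ = ∫⁻ ω in S₁, G ω ∂μ
        + (∫⁻ ω in S₁ᶜ ∩ S₂, G ω ∂μ + ∫⁻ ω in S₁ᶜ \ S₂, G ω ∂μ) := fun G => by
      rw [lintegral_inter_add_sdiff _ _ (hle t _ hS₂), lintegral_add_compl _ (hle t _ hS₁)]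
    rw [split, split, mul_add, mul_add]
    gcongr
  have hpot : ∀ n, ∫⁻ ω, ENNReal.ofReal (W n ω ^ s) ∂μ ≤ ENNReal.ofReal (r ^ n) := by
    intro n
    induction n with
    | zero =>
      calc ∫⁻ ω, ENNReal.ofReal (W 0 ω ^ s) ∂μ ≤ ∫⁻ _, 1 ∂μ := by
            refine lintegral_mono_ae ?_
            filter_upwards [hW01 0] with ω h
            exact ENNReal.ofReal_le_one.2 (Real.rpow_le_one h.1 (by linarith [h.2]) hs0.le)
        _ = ENNReal.ofReal (r ^ 0) := by simp
    | succ n ih =>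
      refine (hstep n).trans ?_
      rw [pow_succ', ENNReal.ofReal_mul hr0.le]
      gcongr
  refine ⟨r ^ (1 + s)⁻¹, Real.rpow_pos_of_pos hr0 _,
    Real.rpow_lt_one hr0.le hr1 (by positivity), fun n => ?_⟩
  set ρ := r ^ (1 + s)⁻¹ with hρ
  have hρ0 : 0 < ρ := Real.rpow_pos_of_pos hr0 _
  have hρr : ρ * ρ ^ s = r := by
    rw [hρ, ← Real.rpow_mul hr0.le, ← Real.rpow_add hr0]
    have : (1 + s)⁻¹ + (1 + s)⁻¹ * s = 1 := by field_simp
    rw [this, Real.rpow_one]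
  refine ENNReal.toReal_le_of_le_ofReal (by positivity) ?_
  have hy : 0 < (ρ ^ s) ^ n := by positivity
  have e : ENNReal.ofReal (ρ ^ n) = ENNReal.ofReal (r ^ n) / ENNReal.ofReal ((ρ ^ s) ^ n) := by
    rw [← ENNReal.ofReal_div_of_pos hy, ← div_pow, ← hρr]
    congr 2
    field_simp
  rw [e, ENNReal.le_div_iff_mul_le (by simp [hy]) (by simp), mul_comm, ← setLIntegral_const]
  have hm : Measurable fun ω => ENNReal.ofReal (W n ω ^ s) :=
    (((hWm n).mono (hle n) le_rfl).pow_const s).ennreal_ofReal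
  refine (setLIntegral_mono hm fun ω hω => ENNReal.ofReal_le_ofReal ?_).trans
    ((setLIntegral_le_lintegral _ _).trans (hpot n))
  have := Real.rpow_le_rpow (by positivity) (le_of_lt (show ρ ^ n < W n ω from hω)) hs0.le
  rwa [← Real.rpow_natCast, ← Real.rpow_mul hρ0.le, mul_comm, Real.rpow_mul hρ0.le,
    Real.rpow_natCast] at this

end Middle

theorem pastSigma_le {Ω : Type} [mΩ : MeasurableSpace Ω] {X : ℕ → Ω → ℝ}
    (hX : ∀ t, Measurable (X t)) (t : ℕ) : pastSigma X t ≤ mΩ :=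
  (measurable_pi_lambda _ fun i : Fin (t + 1) => hX i).comap_le

theorem measurable_pastSigma {Ω : Type} (X : ℕ → Ω → ℝ) {i t : ℕ} (h : i ≤ t) :
    Measurable[pastSigma X t] (X i) :=
  (measurable_pi_apply (⟨i, Nat.lt_succ_of_le h⟩ : Fin (t + 1))).comp
    (comap_measurable fun ω (i : Fin (t + 1)) => X i ω)

theorem pastSigma_mono {Ω : Type} (X : ℕ → Ω → ℝ) (t : ℕ) :
    pastSigma X t ≤ pastSigma X (t + 1) :=
  Measurable.comap_le (m₁ := pastSigma X (t + 1)) <| @measurable_pi_lambda _ _ _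
    (pastSigma X (t + 1)) _ _ fun i => measurable_pastSigma X (i.is_lt.le)

theorem pow_le_inv_mul_rpow_pow {ρ : ℝ} (hρ0 : 0 < ρ) (hρ1 : ρ ≤ 1) {m n t : ℕ} (hm : 0 < m)
    (h : t ≤ (n + 1) * m) : ρ ^ n ≤ ρ⁻¹ * (ρ ^ (m : ℝ)⁻¹) ^ t := by
  have hm' : (0 : ℝ) < m := by exact_mod_cast hm
  have h' : (t : ℝ) ≤ (n + 1) * m := by exact_mod_cast h
  rw [← Real.rpow_natCast, ← Real.rpow_natCast, ← Real.rpow_mul hρ0.le, ← Real.rpow_neg_one,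
    ← Real.rpow_add hρ0]
  apply Real.rpow_le_rpow_of_exponent_ge hρ0 hρ1
  have : (m : ℝ)⁻¹ * t ≤ n + 1 := by
    rw [inv_mul_le_iff₀ hm']
    linarith
  linarith

/-- if a `[0,1]`-martingale is `(η,b)`-exponentially locally polarizing
(it is locally polarizing and has strong suction at the low end) and
`0 < Λ < η·log₂ b`, then it satisfies `Λ`-exponentially strong polarization. -/
theorem stmt0
    {Ω : Type} [MeasurableSpace Ω] (μ : Measure Ω) [IsProbabilityMeasure μ]
    (X : ℕ → Ω → ℝ)
    (hXmeas : ∀ t, Measurable (X t))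
    (hXbdd : ∀ t, ∀ᵐ ω ∂μ, X t ω ∈ Set.Icc (0 : ℝ) 1)
    (hmart : ∀ t, μ[X (t + 1) | pastSigma X t] =ᵐ[μ] X t)
    (η b Λ : ℝ) (hη : 0 < η) (hη1 : η ≤ 1) (hb : 1 < b)
    (hΛ0 : 0 < Λ) (hΛ : Λ < η * Real.logb 2 b)
    -- variance in the middle
    (hvar : ∀ τ : ℝ, 0 < τ → ∃ θ : ℝ, 0 < θ ∧ ∀ j : ℕ, ∀ᵐ ω ∂μ,
        X j ω ∈ Set.Ioo τ (1 - τ) →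
        θ ≤ (μ[fun ω' => (X (j + 1) ω' - X j ω') ^ 2 | pastSigma X j]) ω)
    -- suction at the ends
    (hsuction : ∃ α : ℝ, 0 < α ∧ ∀ c : ℝ, 0 < c → ∃ τ : ℝ, 0 < τ ∧ ∀ j : ℕ,
        (∀ᵐ ω ∂μ, X j ω ≤ τ →
          α ≤ (μ[Set.indicator {ω' | X (j + 1) ω' ≤ X j ω' / c}
                (fun _ => (1 : ℝ)) | pastSigma X j]) ω) ∧
        (∀ᵐ ω ∂μ, 1 - X j ω ≤ τ →
          α ≤ (μ[Set.indicator {ω' | 1 - X (j + 1) ω' ≤ (1 - X j ω') / c}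
                (fun _ => (1 : ℝ)) | pastSigma X j]) ω))
    -- strong suction at the low end
    (hstrong : ∃ τ : ℝ, 0 < τ ∧ ∀ j : ℕ, ∀ᵐ ω ∂μ, X j ω ≤ τ →
        η ≤ (μ[Set.indicator {ω' | X (j + 1) ω' ≤ X j ω' ^ b}
              (fun _ => (1 : ℝ)) | pastSigma X j]) ω) :
    -- Λ-exponentially strong polarization
    ∀ γ : ℝ, 0 < γ → γ < 1 →
      ∃ α ρ : ℝ, 0 < ρ ∧ ρ < 1 ∧ ∀ t : ℕ,
        (μ {ω | (2 : ℝ) ^ (-((2 : ℝ) ^ (Λ * (t : ℝ)))) < X t ω ∧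
                X t ω < 1 - γ ^ t}).toReal ≤ α * ρ ^ t := by

  intro γ hγ0 hγ1
  have hle := pastSigma_le hXmeas
  have hmono := pastSigma_mono X
  have hXm : ∀ t, Measurable[pastSigma X t] (X t) := fun t => measurable_pastSigma X le_rfl
  have hXi : ∀ t, Integrable (X t) μ := fun t =>
    Integrable.of_mem_Icc 0 1 (hXmeas t).aemeasurable (hXbdd t)
  obtain ⟨α₀, hα₀, hsuction⟩ := hsuction
  set α := min α₀ 1 with hα
  have hα0 : 0 < α := lt_min hα₀ one_pos
  have hlow : ∀ c : ℝ, 0 < c → ∃ τ : ℝ, 0 < τ ∧ ∀ j : ℕ, ∀ᵐ ω ∂μ, X j ω ≤ τ →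
      α ≤ (μ[Set.indicator {ω' | X (j + 1) ω' ≤ X j ω' / c}
        (fun _ => (1 : ℝ)) | pastSigma X j]) ω := fun c hc => by
    obtain ⟨τ, hτ, h⟩ := hsuction c hc
    exact ⟨τ, hτ, fun j => (h j).1.mono fun ω h hω => (min_le_left _ _).trans (h hω)⟩
  have hhigh : ∀ c : ℝ, 0 < c → ∃ τ : ℝ, 0 < τ ∧ ∀ j : ℕ, ∀ᵐ ω ∂μ, 1 - X j ω ≤ τ →
      α ≤ (μ[Set.indicator {ω' | 1 - X (j + 1) ω' ≤ (1 - X j ω') / c}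
        (fun _ => (1 : ℝ)) | pastSigma X j]) ω := fun c hc => by
    obtain ⟨τ, hτ, h⟩ := hsuction c hc
    exact ⟨τ, hτ, fun j => (h j).2.mono fun ω h hω => (min_le_left _ _).trans (h hω)⟩
  obtain ⟨ρ, hρ0, hρ1, hmid⟩ := exists_measureReal_mul_one_sub_le hle hXm hXbdd hmart hvar
    hα0 (min_le_right _ _) hlow hhigh
  obtain ⟨τ₁, hτ₁, m₁, hm₁, σ₁, hσ₁0, hσ₁1, hnear0⟩ := exists_measureReal_low_le hle hmono hXm hXi
    (fun t => (hXbdd t).mono fun ω h => h.1) hmart hη1 hb hΛ0 hΛ hstrong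
  have hmart' : ∀ t, μ[fun ω => 1 - X (t + 1) ω | pastSigma X t] =ᵐ[μ] fun ω => 1 - X t ω := by
    intro t
    have h := condExp_sub (integrable_const (1 : ℝ)) (hXi (t + 1)) (pastSigma X t)
    rw [condExp_const (hle t)] at h
    refine h.trans ?_
    filter_upwards [hmart t] with ω h
    simp [h]
  obtain ⟨τ₂, hτ₂, m₂, hm₂, σ₂, hσ₂0, hσ₂1, hnear1⟩ := exists_measureReal_suction_le hle hmono
    (Z := fun t ω => 1 - X t ω) (fun t => measurable_const.sub (hXm t))
    (fun t => (integrable_const 1).sub (hXi t))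
    (fun t => (hXbdd t).mono fun ω h => sub_nonneg.2 h.2) hmart' hα0 (min_le_right _ _) hγ0 hγ1 hhigh
  set m := m₁ * m₂ with hm
  have hm0 : 0 < m := Nat.mul_pos hm₁ hm₂
  set v := ρ ^ (m : ℝ)⁻¹ with hv
  have hv0 : 0 < v := Real.rpow_pos_of_pos hρ0 _
  have hv1 : v < 1 := Real.rpow_lt_one hρ0.le hρ1 (by positivity)
  set R := max v (max σ₁ σ₂) with hR
  have hvR : v ≤ R := le_max_left _ _
  have hσ₁R : σ₁ ≤ R := (le_max_left _ _).trans (le_max_right _ _)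
  have hσ₂R : σ₂ ≤ R := (le_max_right _ _).trans (le_max_right _ _)
  refine ⟨(1 + 2 / τ₁ + 2 / τ₂) * ρ⁻¹ + 2, R, hv0.trans_le hvR,
    max_lt hv1 (max_lt hσ₁1 hσ₂1), fun t => ?_⟩
  obtain ⟨n, k, rfl, hnm, hlt⟩ : ∃ n k, t = n + k ∧ n * m ≤ t ∧ t ≤ (n + 1) * m := by
    refine ⟨t / m, t - t / m, ?_, Nat.div_mul_le_self t m, ?_⟩
    · have := Nat.div_le_self t m
      omega
    · have := Nat.lt_div_mul_add (a := t) hm0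
      rw [add_mul, one_mul]
      exact this.le
  have hn₁ : n * m₁ ≤ n + k :=
    le_trans (Nat.mul_le_mul_left n (Nat.le_mul_of_pos_right m₁ hm₂)) hnm
  have hn₂ : n * m₂ ≤ n + k :=
    le_trans (Nat.mul_le_mul_left n (Nat.le_mul_of_pos_left m₂ hm₁)) hnm
  have h0 := hmid n
  have h1 := hnear0 n k hn₁ (2 * ρ ^ n) (by positivity)
  have h2 := hnear1 n k hn₂ (2 * ρ ^ n) (by positivity)
  have hρn : ρ ^ n ≤ ρ⁻¹ * R ^ (n + k) :=
    (pow_le_inv_mul_rpow_pow hρ0 hρ1.le hm0 hlt).trans (by gcongr)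
  set A := {ω | ρ ^ n < X n ω * (1 - X n ω)} with hA
  set B := {ω | X n ω ≤ 2 * ρ ^ n ∧
    (2 : ℝ) ^ (-((2 : ℝ) ^ (Λ * ((n + k : ℕ) : ℝ)))) < X (n + k) ω} with hB
  set D := {ω | 1 - X n ω ≤ 2 * ρ ^ n ∧ γ ^ (n + k) < 1 - X (n + k) ω} with hD
  have hsub : μ {ω | (2 : ℝ) ^ (-((2 : ℝ) ^ (Λ * ((n + k : ℕ) : ℝ)))) < X (n + k) ω ∧
      X (n + k) ω < 1 - γ ^ (n + k)} ≤ μ (A ∪ (B ∪ D)) := by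
    refine measure_mono_ae ?_
    filter_upwards [hXbdd n] with ω h ⟨hl, hu⟩
    by_cases hw : ρ ^ n < X n ω * (1 - X n ω)
    · exact Or.inl hw
    · right
      have hw := not_lt.1 hw
      rcases le_total (X n ω) (1 / 2) with hx | hx
      · exact Or.inl ⟨by nlinarith [h.1], hl⟩
      · exact Or.inr ⟨by nlinarith [h.2], by linarith⟩
  have hσ₁p : σ₁ ^ (n + k) ≤ R ^ (n + k) := by gcongr
  have hσ₂p : σ₂ ^ (n + k) ≤ R ^ (n + k) := by gcongr
  calc (μ {ω | (2 : ℝ) ^ (-((2 : ℝ) ^ (Λ * ((n + k : ℕ) : ℝ)))) < X (n + k) ω ∧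
        X (n + k) ω < 1 - γ ^ (n + k)}).toReal
      ≤ μ.real (A ∪ (B ∪ D)) := ENNReal.toReal_mono (measure_ne_top _ _) hsub
    _ ≤ μ.real A + (μ.real B + μ.real D) :=
        (measureReal_union_le _ _).trans (by gcongr; exact measureReal_union_le _ _)
    _ ≤ ρ ^ n + ((2 * ρ ^ n / τ₁ + R ^ (n + k)) + (2 * ρ ^ n / τ₂ + R ^ (n + k))) := by
        linarith
    _ = (1 + 2 / τ₁ + 2 / τ₂) * ρ ^ n + 2 * R ^ (n + k) := by ring
    _ ≤ (1 + 2 / τ₁ + 2 / τ₂) * (ρ⁻¹ * R ^ (n + k)) + 2 * R ^ (n + k) := by gcongr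
    _ = ((1 + 2 / τ₁ + 2 / τ₂) * ρ⁻¹ + 2) * R ^ (n + k) := by ring
end

section
/- Let q be a prime, let α ∈ 𝔽_q be nonzero, and let M = [[1,0],[α,1]] ∈ 𝔽_q^{2×2}. Then for every ε > 0, the Kronecker square M⊗M ∈ 𝔽_q^{4×4} satisfies (1/4, 2-ε)-exponential polarization. -/
open scoped BigOperators

/- Probability of an event under a probability mass function on a finite type. -/
open Classical in
noncomputable def pmfProb {Ω : Type} [Fintype Ω] (μ : Ω → ℝ) (S : Set Ω) : ℝ :=
  ∑ ω : Ω, if ω ∈ S then μ ω else 0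

/- Conditional Shannon entropy (base 2) `H(X|Y)` of finitely-valued random variables
on a finite probability space given by the mass function `μ`. -/
open Classical in
noncomputable def condEnt {Ω S T : Type} [Fintype Ω] [Fintype S] [Fintype T]
    (μ : Ω → ℝ) (X : Ω → S) (Y : Ω → T) : ℝ :=
  ∑ s : S, ∑ t : T,
    (if pmfProb μ {ω | X ω = s ∧ Y ω = t} = 0 then 0
     else -(pmfProb μ {ω | X ω = s ∧ Y ω = t}) *
        Real.logb 2 (pmfProb μ {ω | X ω = s ∧ Y ω = t} / pmfProb μ {ω | Y ω = t}))

/- Normalized conditional entropy `H̄(X|Y) = H(X|Y)/log₂ q` for `X` valued in `𝔽_q`. -/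
noncomputable def nCondEnt (q : ℕ) [NeZero q] {Ω T : Type} [Fintype Ω] [Fintype T]
    (μ : Ω → ℝ) (X : Ω → ZMod q) (Y : Ω → T) : ℝ :=
  condEnt μ X Y / Real.logb 2 q

/- A matrix `M ∈ 𝔽_q^{k×k}` satisfies `(η, b)`-exponential polarization. -/
open Classical in
noncomputable def ExpPolar (q : ℕ) [NeZero q] (k : ℕ)
    (M : Matrix (Fin k) (Fin k) (ZMod q)) (η b : ℝ) : Prop :=
  ∃ τ : ℝ, 0 < τ ∧ ∀ δ : ℝ, 0 ≤ δ → δ < τ →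
    ∀ (Ω Alph : Type) [Fintype Ω] [Fintype Alph] (μ : Ω → ℝ),
      (∀ ω, 0 ≤ μ ω) → (∑ ω : Ω, μ ω = 1) →
      ∀ (U : Fin k → Ω → ZMod q) (A : Fin k → Ω → Alph),
      -- the pairs (U_i, A_i) are i.i.d. with common marginal p
      (∃ p : ZMod q × Alph → ℝ,
        (∀ (i : Fin k) (u : ZMod q) (a : Alph),
            pmfProb μ {ω | U i ω = u ∧ A i ω = a} = p (u, a)) ∧
        (∀ (u : Fin k → ZMod q) (a : Fin k → Alph),
            pmfProb μ {ω | ∀ i, U i ω = u i ∧ A i ω = a i} = ∏ i, p (u i, a i))) →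
      (∀ i : Fin k, nCondEnt q μ (U i) (A i) ≤ δ) →
      η * k ≤ ((Finset.univ : Finset (Fin k)).filter (fun j : Fin k =>
        nCondEnt q μ (fun ω => Matrix.vecMul (fun i => U i ω) M j)
          (fun ω => ((fun i : Fin (j : ℕ) =>
              Matrix.vecMul (fun i' => U i' ω) M (Fin.castLE j.isLt.le i)),
            (fun i => A i ω))) ≤ δ ^ b)).card

/- A matrix is mixing if it is invertible and no row permutation of it is upper triangular. -/
def IsMixing {q k : ℕ} (M : Matrix (Fin k) (Fin k) (ZMod q)) : Prop :=
  IsUnit M.det ∧ ∀ σ : Equiv.Perm (Fin k), ¬ (∀ i j : Fin k, j < i → M (σ i) j = 0)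

/- The Kronecker square `M ⊗ M`, with the standard (lexicographic) indexing by `Fin (k*k)`. -/
noncomputable def kron2 {q k : ℕ} (M : Matrix (Fin k) (Fin k) (ZMod q)) :
    Matrix (Fin (k * k)) (Fin (k * k)) (ZMod q) :=
  Matrix.reindex finProdFinEquiv finProdFinEquiv (Matrix.kroneckerMap (· * ·) M M)


section Probability

variable {Ω : Type} [Fintype Ω] {μ : Ω → ℝ}

lemma pmfProb_nonneg (hμ : ∀ ω, 0 ≤ μ ω) (S : Set Ω) : 0 ≤ pmfProb μ S := by
  classical
  unfold pmfProb
  exact Finset.sum_nonneg fun ω _ => by split_ifs <;> simp [hμ]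

lemma pmfProb_mono (hμ : ∀ ω, 0 ≤ μ ω) {S T : Set Ω} (h : S ⊆ T) :
    pmfProb μ S ≤ pmfProb μ T := by
  classical
  unfold pmfProb
  refine Finset.sum_le_sum fun ω _ => ?_
  by_cases hS : ω ∈ S
  · simp [hS, h hS]
  · simp only [hS, if_false]
    split_ifs <;> simp [hμ]

lemma pmfProb_union_le (hμ : ∀ ω, 0 ≤ μ ω) (S T : Set Ω) :
    pmfProb μ (S ∪ T) ≤ pmfProb μ S + pmfProb μ T := by
  classical
  unfold pmfProb
  rw [← Finset.sum_add_distrib]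
  refine Finset.sum_le_sum fun ω _ => ?_
  have := hμ ω
  by_cases hS : ω ∈ S <;> by_cases hT : ω ∈ T <;> simp [hS, hT, this]

lemma pmfProb_univ (h1 : ∑ ω, μ ω = 1) : pmfProb μ Set.univ = 1 := by
  simpa [pmfProb] using h1

lemma pmfProb_mem_eq_sum {Z : Type} (X : Ω → Z) (P : Finset Z) :
    pmfProb μ {ω | X ω ∈ P} = ∑ z ∈ P, pmfProb μ {ω | X ω = z} := by
  classical
  unfold pmfProb
  rw [Finset.sum_comm]
  exact Finset.sum_congr rfl fun ω _ => by simp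

lemma sum_pmfProb_fst {S T : Type} [Fintype S] (X : Ω → S) (Y : Ω → T) (t : T) :
    ∑ s, pmfProb μ {ω | X ω = s ∧ Y ω = t} = pmfProb μ {ω | Y ω = t} := by
  classical
  unfold pmfProb
  rw [Finset.sum_comm]
  refine Finset.sum_congr rfl fun ω _ => ?_
  by_cases h : Y ω = t <;> simp [h]

lemma sum_pmfProb_eq_one {T : Type} [Fintype T] (h1 : ∑ ω, μ ω = 1) (Y : Ω → T) :
    ∑ t, pmfProb μ {ω | Y ω = t} = 1 := by
  classical
  rw [← pmfProb_mem_eq_sum]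
  simpa using pmfProb_univ h1

lemma pmfProb_ne_comp {S T : Type} [Fintype S] [Fintype T] [DecidableEq S]
    (X : Ω → S) (Y : Ω → T) (g : T → S) :
    pmfProb μ {ω | X ω ≠ g (Y ω)} =
      ∑ s, ∑ t, if s = g t then 0 else pmfProb μ {ω | X ω = s ∧ Y ω = t} := by
  classical
  have := pmfProb_mem_eq_sum (μ := μ) (fun ω => (X ω, Y ω))
    (Finset.univ.filter fun z : S × T => z.1 ≠ g z.2)
  simp only [Finset.mem_filter, Finset.mem_univ, true_and, Finset.sum_filter,
    Fintype.sum_prod_type, Prod.ext_iff] at this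
  rw [this]
  simp [ite_not]

lemma pmfProb_pi_mem {ι Z : Type} [Fintype ι] [DecidableEq ι] [Fintype Z] (X : ι → Ω → Z)
    (p : Z → ℝ) (hp : ∀ i z, pmfProb μ {ω | X i ω = z} = p z)
    (hind : ∀ z : ι → Z, pmfProb μ {ω | ∀ i, X i ω = z i} = ∏ i, p (z i))
    (P : ι → Finset Z) :
    pmfProb μ {ω | ∀ i, X i ω ∈ P i} = ∏ i, pmfProb μ {ω | X i ω ∈ P i} := by
  classical
  have h := pmfProb_mem_eq_sum (μ := μ) (fun ω i => X i ω) (Fintype.piFinset P)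
  simp only [Fintype.mem_piFinset, funext_iff, hind] at h
  rw [h, ← Finset.prod_univ_sum P fun _ => p]
  exact Finset.prod_congr rfl fun i _ => by rw [pmfProb_mem_eq_sum]; simp [hp]

lemma pmfProb_pi_pair {ι Z : Type} [Fintype ι] [DecidableEq ι] [Fintype Z] (X : ι → Ω → Z)
    (h1 : ∑ ω, μ ω = 1)
    (p : Z → ℝ) (hp : ∀ i z, pmfProb μ {ω | X i ω = z} = p z)
    (hind : ∀ z : ι → Z, pmfProb μ {ω | ∀ i, X i ω = z i} = ∏ i, p (z i))
    (E : ι → Set Z) {i j : ι} (hij : i ≠ j) :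
    pmfProb μ {ω | X i ω ∈ E i ∧ X j ω ∈ E j} =
      pmfProb μ {ω | X i ω ∈ E i} * pmfProb μ {ω | X j ω ∈ E j} := by
  classical
  have h := pmfProb_pi_mem X p hp hind
    (fun k => if k = i ∨ k = j then Finset.univ.filter (· ∈ E k) else Finset.univ)
  have hset : {ω | ∀ k, X k ω ∈
      (if k = i ∨ k = j then Finset.univ.filter (· ∈ E k) else Finset.univ)} =
      {ω | X i ω ∈ E i ∧ X j ω ∈ E j} := by
    ext ω
    simp only [Set.mem_ofPred_eq]
    constructor
    · intro H
      exact ⟨by simpa using H i, by simpa using H j⟩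
    · rintro ⟨hi, hj⟩ k
      split_ifs with hk
      · rcases hk with rfl | rfl <;> simpa
      · simp
  rw [hset] at h
  rw [h, Finset.prod_eq_mul i j hij]
  · simp
  · intro k _ hk
    simpa [hk.1, hk.2] using pmfProb_univ h1
  · simp
  · simp

end Probability

section Entropy

variable {Ω S T : Type} [Fintype Ω] [Fintype S] [Fintype T] {μ : Ω → ℝ}

open Classical in
lemma condEnt_mul_log_two (X : Ω → S) (Y : Ω → T) :
    condEnt μ X Y * Real.log 2 = ∑ s, ∑ t, -(pmfProb μ {ω | X ω = s ∧ Y ω = t} *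
      Real.log (pmfProb μ {ω | X ω = s ∧ Y ω = t} / pmfProb μ {ω | Y ω = t})) := by
  have h2 : Real.log 2 ≠ 0 := (Real.log_pos one_lt_two).ne'
  unfold condEnt
  simp only [Finset.sum_mul]
  refine Finset.sum_congr rfl fun s _ => Finset.sum_congr rfl fun t _ => ?_
  split_ifs with h
  · simp [h]
  · rw [Real.logb]
    field_simp

/-- A Fano-type inequality: a predictor of `X` from `Y` with small error probability bounds the
conditional entropy. -/
lemma condEnt_le_of_predictor (hμ : ∀ ω, 0 ≤ μ ω) (h1 : ∑ ω, μ ω = 1)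
    (X : Ω → S) (Y : Ω → T) (g : T → S) {θ : ℝ} (hθ : 0 < θ) (hθ2 : θ ≤ 1 / 2) :
    condEnt μ X Y * Real.log 2 ≤
      2 * θ + pmfProb μ {ω | X ω ≠ g (Y ω)} * Real.log (Fintype.card S / θ) := by
  classical
  obtain ⟨ω₀⟩ : Nonempty Ω := by
    by_contra h
    rw [not_nonempty_iff] at h
    simp at h1
  have hc : (1 : ℝ) ≤ Fintype.card S := by
    exact_mod_cast Fintype.card_pos_iff.mpr ⟨X ω₀⟩
  have hc0 : (0 : ℝ) < Fintype.card S := by linarith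
  have hlog : 0 ≤ Real.log (Fintype.card S / θ) :=
    Real.log_nonneg (by rw [le_div_iff₀ hθ]; linarith)
  set Q : S → T → ℝ := fun s t => if s = g t then 1 - θ else θ / Fintype.card S with hQ
  have hQpos : ∀ s t, 0 < Q s t := by
    intro s t
    simp only [hQ]
    split_ifs
    · linarith
    · positivity
  have hQlog : ∀ s t, -Real.log (Q s t) ≤
      2 * θ + if s = g t then 0 else Real.log (Fintype.card S / θ) := by
    intro s t
    simp only [hQ]
    split_ifs
    · have h := Real.one_sub_inv_le_log_of_pos (show (0 : ℝ) < 1 - θ by linarith)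
      have h' : (1 - θ)⁻¹ ≤ 1 + 2 * θ := by
        rw [inv_le_comm₀ (by linarith) (by linarith), inv_le_iff_one_le_mul₀ (by linarith)]
        nlinarith
      linarith
    · rw [← Real.log_inv, inv_div]
      linarith
  have hQsum : ∀ t, ∑ s, Q s t ≤ 1 := by
    intro t
    have : ∀ s, Q s t ≤ (if s = g t then 1 - θ else 0) + θ / Fintype.card S := by
      intro s
      simp only [hQ]
      split_ifs
      · have : 0 < θ / Fintype.card S := by positivity
        linarith
      · linarith
    refine (Finset.sum_le_sum fun s _ => this s).trans ?_
    rw [Finset.sum_add_distrib]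
    simp only [Finset.sum_ite_eq', Finset.mem_univ, if_true, Finset.sum_const,
      Finset.card_univ, nsmul_eq_mul]
    rw [mul_div_cancel₀ _ hc0.ne']
    linarith
  set J : S → T → ℝ := fun s t => pmfProb μ {ω | X ω = s ∧ Y ω = t} with hJ
  set R : T → ℝ := fun t => pmfProb μ {ω | Y ω = t} with hR
  have hJ0 : ∀ s t, 0 ≤ J s t := fun s t => pmfProb_nonneg hμ _
  have hR0 : ∀ t, 0 ≤ R t := fun t => pmfProb_nonneg hμ _
  have hJR : ∀ s t, J s t ≤ R t := fun s t => pmfProb_mono hμ fun ω h => h.2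
  have hJs : ∀ t, ∑ s, J s t = R t := fun t => sum_pmfProb_fst X Y t
  have hRs : ∑ t, R t = 1 := sum_pmfProb_eq_one h1 Y
  have hterm : ∀ s t, -(J s t * Real.log (J s t / R t)) ≤ J s t * (2 * θ) +
      (if s = g t then 0 else J s t) * Real.log (Fintype.card S / θ) +
        (R t * Q s t - J s t) := by
    intro s t
    have hq := mul_le_mul_of_nonneg_left (hQlog s t) (hJ0 s t)
    have hq' : -(J s t * Real.log (J s t / R t)) ≤
        J s t * -Real.log (Q s t) + (R t * Q s t - J s t) := by
      rcases (hJ0 s t).eq_or_lt with h | h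
      · rw [← h]
        have := mul_nonneg (hR0 t) (hQpos s t).le
        simpa using this
      · have hRt : 0 < R t := h.trans_le (hJR s t)
        have hl := Real.log_le_sub_one_of_pos (show 0 < R t * Q s t / J s t from
          div_pos (mul_pos hRt (hQpos s t)) h)
        rw [Real.log_div (mul_pos hRt (hQpos s t)).ne' h.ne',
          Real.log_mul hRt.ne' (hQpos s t).ne'] at hl
        have hl' := mul_le_mul_of_nonneg_left hl h.le
        rw [mul_sub (J s t) (_ / _), mul_div_cancel₀ _ h.ne'] at hl'
        rw [Real.log_div h.ne' hRt.ne']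
        linarith
    refine hq'.trans ?_
    split_ifs at hq ⊢ <;> linarith
  rw [condEnt_mul_log_two]
  refine (Finset.sum_le_sum fun s _ => Finset.sum_le_sum fun t _ => hterm s t).trans ?_
  have e1 : ∑ s, ∑ t, J s t = 1 := by
    rw [Finset.sum_comm, ← hRs]
    exact Finset.sum_congr rfl fun t _ => hJs t
  have e2 : ∑ s, ∑ t, R t * Q s t ≤ 1 := by
    rw [Finset.sum_comm, ← hRs]
    refine Finset.sum_le_sum fun t _ => ?_
    rw [← Finset.mul_sum]
    exact mul_le_of_le_one_right (hR0 t) (hQsum t)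
  rw [pmfProb_ne_comp]
  simp only [Finset.sum_add_distrib, Finset.sum_sub_distrib, ← Finset.sum_mul]
  rw [e1]
  linarith

/-- The maximum-likelihood predictor errs with probability at most the conditional entropy. -/
lemma exists_predictor_error_le (hμ : ∀ ω, 0 ≤ μ ω) [Nonempty S] (X : Ω → S) (Y : Ω → T) :
    ∃ g : T → S, pmfProb μ {ω | X ω ≠ g (Y ω)} ≤ condEnt μ X Y * Real.log 2 := by
  classical
  set J : S → T → ℝ := fun s t => pmfProb μ {ω | X ω = s ∧ Y ω = t} with hJ
  set R : T → ℝ := fun t => pmfProb μ {ω | Y ω = t} with hR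
  have hJ0 : ∀ s t, 0 ≤ J s t := fun s t => pmfProb_nonneg hμ _
  have hR0 : ∀ t, 0 ≤ R t := fun t => pmfProb_nonneg hμ _
  have hJR : ∀ s t, J s t ≤ R t := fun s t => pmfProb_mono hμ fun ω h => h.2
  have hJs : ∀ t, ∑ s, J s t = R t := fun t => sum_pmfProb_fst X Y t
  choose g hg using fun t => Finite.exists_max fun s => J s t
  refine ⟨g, ?_⟩
  rw [pmfProb_ne_comp, condEnt_mul_log_two, Finset.sum_comm, Finset.sum_comm
    (s := Finset.univ (α := S))]
  refine Finset.sum_le_sum fun t _ => ?_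
  have hterm : ∀ s, J s t * (1 - J (g t) t / R t) ≤ -(J s t * Real.log (J s t / R t)) := by
    intro s
    rcases (hJ0 s t).eq_or_lt with h | h
    · simp [← h]
    · have hRt : 0 < R t := h.trans_le (hJR s t)
      have hl := Real.log_le_sub_one_of_pos (div_pos h hRt)
      have hm : J s t / R t ≤ J (g t) t / R t := by gcongr; exact hg t s
      rw [← mul_neg]
      exact mul_le_mul_of_nonneg_left (by linarith) h.le
  refine le_trans ?_ (Finset.sum_le_sum fun s _ => hterm s)
  rw [← Finset.sum_mul, hJs]
  have hsum : (∑ s, if s = g t then 0 else J s t) = R t - J (g t) t := by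
    rw [← hJs t, ← Finset.sum_erase_eq_sub (Finset.mem_univ (g t)),
      ← Finset.filter_ne', Finset.sum_filter]
    simp [ite_not]
  refine hsum.le.trans ?_
  rcases (hR0 t).eq_or_lt with h | h
  · have := hJ0 (g t) t
    rw [← h]; linarith
  · rw [mul_sub, mul_div_cancel₀ _ h.ne', mul_one]

end Entropy

section Kronecker

variable {q : ℕ} (α : ZMod q) (u : Fin (2 * 2) → ZMod q)

lemma vecMul_kron2_three :
    Matrix.vecMul u (kron2 (!![1, 0; α, 1] : Matrix (Fin 2) (Fin 2) (ZMod q))) 3 = u 3 := by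
  have h0 : finProdFinEquiv.symm (0 : Fin (2 * 2)) = ((0 : Fin 2), (0 : Fin 2)) := by decide
  have h1 : finProdFinEquiv.symm (1 : Fin (2 * 2)) = ((0 : Fin 2), (1 : Fin 2)) := by decide
  have h2 : finProdFinEquiv.symm (2 : Fin (2 * 2)) = ((1 : Fin 2), (0 : Fin 2)) := by decide
  have h3 : finProdFinEquiv.symm (3 : Fin (2 * 2)) = ((1 : Fin 2), (1 : Fin 2)) := by decide
  simp [Matrix.vecMul, dotProduct, kron2, Fin.sum_univ_four, h0, h1, h2, h3]

lemma vecMul_kron2_one :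
    Matrix.vecMul u (kron2 (!![1, 0; α, 1] : Matrix (Fin 2) (Fin 2) (ZMod q))) 1 =
      u 1 + α * u 3 := by
  have h0 : finProdFinEquiv.symm (0 : Fin (2 * 2)) = ((0 : Fin 2), (0 : Fin 2)) := by decide
  have h1 : finProdFinEquiv.symm (1 : Fin (2 * 2)) = ((0 : Fin 2), (1 : Fin 2)) := by decide
  have h2 : finProdFinEquiv.symm (2 : Fin (2 * 2)) = ((1 : Fin 2), (0 : Fin 2)) := by decide
  have h3 : finProdFinEquiv.symm (3 : Fin (2 * 2)) = ((1 : Fin 2), (1 : Fin 2)) := by decide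
  simp [Matrix.vecMul, dotProduct, kron2, Fin.sum_univ_four, h0, h1, h2, h3, mul_comm]

lemma vecMul_kron2_two :
    Matrix.vecMul u (kron2 (!![1, 0; α, 1] : Matrix (Fin 2) (Fin 2) (ZMod q))) 2 =
      u 2 + α * u 3 := by
  have h0 : finProdFinEquiv.symm (0 : Fin (2 * 2)) = ((0 : Fin 2), (0 : Fin 2)) := by decide
  have h1 : finProdFinEquiv.symm (1 : Fin (2 * 2)) = ((0 : Fin 2), (1 : Fin 2)) := by decide
  have h2 : finProdFinEquiv.symm (2 : Fin (2 * 2)) = ((1 : Fin 2), (0 : Fin 2)) := by decide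
  have h3 : finProdFinEquiv.symm (3 : Fin (2 * 2)) = ((1 : Fin 2), (1 : Fin 2)) := by decide
  simp [Matrix.vecMul, dotProduct, kron2, Fin.sum_univ_four, h0, h1, h2, h3, mul_comm]

end Kronecker

/-- Majority-type decoding from `w₁ = u₁ + α u₃`, `w₂ = u₂ + α u₃` and estimates of the `uᵢ`
fails only if two of the three estimates are wrong. -/
lemma majority_decode {K : Type*} [Field K] [DecidableEq K] {α : K} (hα : α ≠ 0)
    {u₁ u₂ u₃ v₁ v₂ v₃ : K}
    (h : u₃ ≠ if u₁ + α * u₃ - v₁ = u₂ + α * u₃ - v₂ then α⁻¹ * (u₁ + α * u₃ - v₁) else v₃) :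
    (u₁ ≠ v₁ ∧ u₂ ≠ v₂) ∨ (u₁ ≠ v₁ ∧ u₃ ≠ v₃) ∨ (u₂ ≠ v₂ ∧ u₃ ≠ v₃) := by
  by_cases h₁ : u₁ = v₁
  · by_cases h₂ : u₂ = v₂
    · subst h₁ h₂
      simp [hα] at h
    · subst h₁
      refine Or.inr (Or.inr ⟨h₂, ?_⟩)
      rintro rfl
      split_ifs at h with hc
      · exact h₂ (by linear_combination -hc)
      · exact h rfl
  · by_cases h₂ : u₂ = v₂
    · subst h₂
      refine Or.inr (Or.inl ⟨h₁, ?_⟩)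
      rintro rfl
      split_ifs at h with hc
      · exact h₁ (by linear_combination hc)
      · exact h rfl
    · exact Or.inl ⟨h₁, h₂⟩

lemma exists_forall_sq_mul_log_le_rpow (a b : ℝ) {ε : ℝ} (hε : 0 < ε) :
    ∃ τ : ℝ, 0 < τ ∧ ∀ δ : ℝ, 0 < δ → δ < τ →
      δ ^ 2 * (a - b * Real.log δ) ≤ δ ^ (2 - ε) := by
  have h1 : Filter.Tendsto (fun x : ℝ => x ^ ε) (nhdsWithin 0 (Set.Ioi 0)) (nhds 0) := by
    have := (Real.continuousAt_rpow_const 0 ε (Or.inr hε.le)).tendsto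
    rw [Real.zero_rpow hε.ne'] at this
    exact this.mono_left nhdsWithin_le_nhds
  have h2 := tendsto_log_mul_rpow_nhdsGT_zero hε
  have h3 := (h1.const_mul a).sub (h2.const_mul b)
  simp only [mul_zero, sub_zero] at h3
  have h4 := h3.eventually (eventually_le_nhds (zero_lt_one (α := ℝ)))
  obtain ⟨τ, hτ, h⟩ := mem_nhdsGT_iff_exists_Ioo_subset.mp h4
  refine ⟨τ, hτ, fun δ h0 hδ => ?_⟩
  have h5 : a * δ ^ ε - b * (Real.log δ * δ ^ ε) ≤ 1 := h ⟨h0, hδ⟩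
  rw [Real.rpow_sub h0, le_div_iff₀ (Real.rpow_pos_of_pos h0 ε), Real.rpow_two]
  nlinarith [mul_le_mul_of_nonneg_left h5 (sq_nonneg δ)]

/-- For prime `q` and nonzero `α ∈ 𝔽_q`, the Kronecker square of
`M = [[1,0],[α,1]]` satisfies `(1/4, 2-ε)`-exponential polarization for every `ε > 0`. -/
theorem stmt3 (q : ℕ) [NeZero q] (hq : Nat.Prime q) (α : ZMod q) (hα : α ≠ 0)
    (ε : ℝ) (hε : 0 < ε) :
    ExpPolar q (2 * 2) (kron2 (!![1, 0; α, 1] : Matrix (Fin 2) (Fin 2) (ZMod q)))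
      (1 / 4) (2 - ε) := by
  classical
  have : Fact q.Prime := ⟨hq⟩
  set L := Real.log q with hL
  have hLpos : 0 < L := Real.log_pos (by exact_mod_cast hq.one_lt)
  have hl2 : 0 < Real.log 2 := Real.log_pos one_lt_two
  have hqpos : (0 : ℝ) < q := by exact_mod_cast hq.pos
  obtain ⟨τ, hτ, hbound⟩ :=
    exists_forall_sq_mul_log_le_rpow ((2 + 3 * L ^ 3) / L) (6 * L) hε
  refine ⟨min τ (1 / 2), lt_min hτ (by norm_num), ?_⟩
  intro δ hδ0 hδτ Ω Alph _ _ μ hμ h1 U A ⟨p, hp, hind⟩ hH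
  have hnats : ∀ {T : Type} [Fintype T] (X : Ω → ZMod q) (Y : Ω → T),
      nCondEnt q μ X Y = condEnt μ X Y * Real.log 2 / L := by
    intro T _ X Y
    rw [nCondEnt, Real.logb, div_div_eq_mul_div]
  choose g hg using fun i => exists_predictor_error_le hμ (U i) (A i)
  have herr : ∀ i, pmfProb μ {ω | U i ω ≠ g i (A i ω)} ≤ δ * L := by
    intro i
    have := hH i
    rw [hnats, div_le_iff₀ hLpos] at this
    exact (hg i).trans this
  have hpair : ∀ i j, i ≠ j →
      pmfProb μ {ω | U i ω ≠ g i (A i ω) ∧ U j ω ≠ g j (A j ω)} ≤ (δ * L) ^ 2 := by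
    intro i j hij
    have h := pmfProb_pi_pair (μ := μ) (fun i ω => (U i ω, A i ω)) h1 p
      (fun i z => by simpa [Prod.ext_iff] using hp i z.1 z.2)
      (fun z => by
        simpa [Prod.ext_iff] using hind (fun i => (z i).1) (fun i => (z i).2))
      (fun i => {z | z.1 ≠ g i z.2}) hij
    simp only [Set.mem_ofPred_eq] at h
    rw [h, sq]
    exact mul_le_mul (herr i) (herr j) (pmfProb_nonneg hμ _) (by positivity)
  set M := kron2 (!![1, 0; α, 1] : Matrix (Fin 2) (Fin 2) (ZMod q)) with hM
  set X : Ω → ZMod q := fun ω => Matrix.vecMul (fun i => U i ω) M 3 with hX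
  set Y : Ω → (Fin 3 → ZMod q) × (Fin (2 * 2) → Alph) := fun ω =>
    ((fun i : Fin 3 => Matrix.vecMul (fun i' => U i' ω) M (Fin.castLE (by norm_num) i)),
      (fun i => A i ω)) with hY
  set dec : (Fin 3 → ZMod q) × (Fin (2 * 2) → Alph) → ZMod q := fun y =>
    if y.1 1 - g 1 (y.2 1) = y.1 2 - g 2 (y.2 2) then α⁻¹ * (y.1 1 - g 1 (y.2 1))
    else g 3 (y.2 3) with hdec
  have hY1 : ∀ ω, (Y ω).1 1 = U 1 ω + α * U 3 ω := fun ω =>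
    vecMul_kron2_one α (fun i => U i ω)
  have hY2 : ∀ ω, (Y ω).1 2 = U 2 ω + α * U 3 ω := fun ω =>
    vecMul_kron2_two α (fun i => U i ω)
  have hX3 : ∀ ω, X ω = U 3 ω := fun ω => vecMul_kron2_three α (fun i => U i ω)
  have hdecerr : pmfProb μ {ω | X ω ≠ dec (Y ω)} ≤ 3 * (δ * L) ^ 2 := by
    have hsub : {ω | X ω ≠ dec (Y ω)} ⊆
        {ω | U 1 ω ≠ g 1 (A 1 ω) ∧ U 2 ω ≠ g 2 (A 2 ω)} ∪
        ({ω | U 1 ω ≠ g 1 (A 1 ω) ∧ U 3 ω ≠ g 3 (A 3 ω)} ∪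
        {ω | U 2 ω ≠ g 2 (A 2 ω) ∧ U 3 ω ≠ g 3 (A 3 ω)}) := by
      intro ω hω
      simp only [Set.mem_ofPred_eq, hdec, hY1, hY2, hX3] at hω
      exact majority_decode hα hω
    refine (pmfProb_mono hμ hsub).trans ((pmfProb_union_le hμ _ _).trans ?_)
    have := pmfProb_union_le hμ {ω | U 1 ω ≠ g 1 (A 1 ω) ∧ U 3 ω ≠ g 3 (A 3 ω)}
        {ω | U 2 ω ≠ g 2 (A 2 ω) ∧ U 3 ω ≠ g 3 (A 3 ω)}
    linarith [hpair 1 2 (by decide), hpair 1 3 (by decide), hpair 2 3 (by decide)]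
  have hfano := fun {θ : ℝ} => condEnt_le_of_predictor hμ h1 X Y dec (θ := θ)
  rw [ZMod.card] at hfano
  have hfinal : nCondEnt q μ X Y ≤ δ ^ (2 - ε) := by
    rw [hnats]
    rcases hδ0.eq_or_lt with h0 | h0
    · have hle : condEnt μ X Y * Real.log 2 ≤ 0 := by
        refine le_of_forall_pos_le_add fun e he => ?_
        have hpe : pmfProb μ {ω | X ω ≠ dec (Y ω)} = 0 :=
          le_antisymm (by simpa [← h0] using hdecerr) (pmfProb_nonneg hμ _)
        have := hfano (θ := min (e / 2) (1 / 2)) (by positivity) (min_le_right _ _)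
        rw [hpe] at this
        linarith [min_le_left (e / 2) (1 / 2)]
      exact (div_nonpos_of_nonpos_of_nonneg hle hLpos.le).trans (Real.rpow_nonneg hδ0 _)
    · have hδ2 : δ < 1 / 2 := hδτ.trans_le (min_le_right _ _)
      refine le_trans ?_ (hbound δ h0 (hδτ.trans_le (min_le_left _ _)))
      have hlog : Real.log (q / δ ^ 2) = L - 2 * Real.log δ := by
        rw [Real.log_div hqpos.ne' (by positivity), Real.log_pow]
        norm_num [hL]
      have hlogpos : 0 ≤ L - 2 * Real.log δ := by
        linarith [Real.log_neg h0 (by linarith)]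
      have := hfano (θ := δ ^ 2) (by positivity) (by nlinarith)
      rw [hlog] at this
      have h' := mul_le_mul_of_nonneg_right hdecerr hlogpos
      rw [div_le_iff₀ hLpos]
      refine (this.trans (add_le_add_right h' _)).trans (le_of_eq ?_)
      field_simp
      ring
  refine le_trans (b := (1 : ℝ)) (by norm_num) (Nat.one_le_cast.mpr (Finset.card_pos.mpr
    ⟨(3 : Fin (2 * 2)), ?_⟩))
  rw [Finset.mem_filter]
  exact ⟨Finset.mem_univ _, hfinal⟩
end

section
/- Let R ∈ 𝔽_q^{m×m} and M ∈ 𝔽_q^{k×k} satisfy R ⊑_u M (useful containment), and let U ∈ 𝔽_q^{k×k} be an invertible upper-triangular matrix with all diagonal entries equal to 1. Then R ⊑_u M·U⁻¹. -/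
/- `UsefulContains R M` : `M` contains `R` in a useful way (`R ⊑_u M`): there are a
permutation matrix `P` (given by the row permutation `σ`) and `T ∈ 𝔽_q^{k×m}` with
`P M T = [R ; 0]`, and the last nonzero row of `T` (row `j₀`) equals `α·e_m`, `α ≠ 0`. -/
def UsefulContains {q k m : ℕ} (R : Matrix (Fin m) (Fin m) (ZMod q))
    (M : Matrix (Fin k) (Fin k) (ZMod q)) : Prop :=
  ∃ (T : Matrix (Fin k) (Fin m) (ZMod q)) (σ : Equiv.Perm (Fin k)) (j₀ : Fin k) (α : ZMod q),
    α ≠ 0 ∧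
    (∀ (i : Fin k) (j : Fin m),
      (M.submatrix σ id * T) i j = if h : (i : ℕ) < m then R ⟨(i : ℕ), h⟩ j else 0) ∧
    (∀ i : Fin k, j₀ < i → ∀ j : Fin m, T i j = 0) ∧
    (∀ j : Fin m, T j₀ j = if (j : ℕ) = m - 1 then α else 0)

/-- useful containment is preserved by right multiplication with the
inverse of an invertible unit-diagonal upper-triangular matrix. -/
theorem stmt5 (q : ℕ) (hq : Nat.Prime q) {k m : ℕ}
    (R : Matrix (Fin m) (Fin m) (ZMod q)) (M U : Matrix (Fin k) (Fin k) (ZMod q))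
    (hRM : UsefulContains R M)
    (hUupper : ∀ i j : Fin k, j < i → U i j = 0)
    (hUdiag : ∀ i : Fin k, U i i = 1)
    (hUinv : IsUnit U.det) :
    UsefulContains R (M * U⁻¹) := by
  obtain ⟨T, σ, j₀, α, hα, hT, hzero, hrow⟩ := hRM
  have hmul : (M * U⁻¹).submatrix σ id * (U * T) = M.submatrix σ id * T := by
    have hsub : (M * U⁻¹).submatrix σ id = M.submatrix σ id * U⁻¹ := rfl
    rw [hsub, Matrix.mul_assoc, Matrix.nonsing_inv_mul_cancel_left U T hUinv]
  refine ⟨U * T, σ, j₀, α, hα, fun i j => by rw [hmul, hT], fun i hi j => ?_, fun j => ?_⟩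
  · rw [Matrix.mul_apply]
    refine Finset.sum_eq_zero fun l _ => ?_
    rcases lt_or_ge l i with hl | hl
    · rw [hUupper i l hl, zero_mul]
    · rw [hzero l (hi.trans_le hl), mul_zero]
  · rw [Matrix.mul_apply, Finset.sum_eq_single j₀, hUdiag, one_mul, hrow]
    · intro l _ hl
      rcases lt_or_gt_of_ne hl with hl | hl
      · rw [hUupper j₀ l hl, zero_mul]
      · rw [hzero l hl, mul_zero]
    · exact fun h => absurd (Finset.mem_univ j₀) h
end

section
/- For every prime q and every mixing matrix M ∈ 𝔽_q^{k×k}, there exists a nonzero α ∈ 𝔽_q such that M contains the matrix H = [[1,0],[α,1]] ∈ 𝔽_q^{2×2} in a useful way, i.e. H ⊑_u M. -/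
theorem Matrix.exists_last_ne_zero {K n : Type*} [Zero K] [Fintype n] [LinearOrder n]
    {v : n → K} (hv : v ≠ 0) : ∃ i, v i ≠ 0 ∧ ∀ j, i < j → v j = 0 := by
  classical
  obtain ⟨i₀, hi₀⟩ := Function.ne_iff.mp hv
  obtain ⟨i, hi, hmax⟩ :=
    (Finset.univ.filter fun i => v i ≠ 0).exists_max_image id ⟨i₀, by simpa using hi₀⟩
  refine ⟨i, by simpa using hi, fun j hij => ?_⟩
  by_contra hj
  exact (hmax j (by simpa using hj)).not_gt hij

/-- If no row permutation of an invertible matrix is upper triangular, then two columns of the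
inverse have their last nonzero entry in the same row. -/
theorem Matrix.exists_columns_inv_same_last {K : Type*} [Field K] {n : Type*} [Fintype n]
    [LinearOrder n] {M : Matrix n n K} (hdet : IsUnit M.det)
    (hM : ∀ σ : Equiv.Perm n, ¬ ∀ i j : n, j < i → M (σ i) j = 0) :
    ∃ (a b r : n), a ≠ b ∧ M⁻¹ r a ≠ 0 ∧ M⁻¹ r b ≠ 0 ∧
      ∀ i, r < i → M⁻¹ i a = 0 ∧ M⁻¹ i b = 0 := by
  have hcol (c : n) : (fun r => M⁻¹ r c) ≠ 0 := by
    intro h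
    have h1 := congrFun (congrFun (M.mul_nonsing_inv hdet) c) c
    rw [Matrix.mul_apply] at h1
    simp [fun r => congrFun h r] at h1
  choose l hl hlast using fun c => Matrix.exists_last_ne_zero (hcol c)
  have hinj : ¬ Function.Injective l := by
    intro hinj
    let σ := (Equiv.ofBijective l (Finite.injective_iff_bijective.mp hinj)).symm
    have hσ (j : n) : l (σ j) = j :=
      (Equiv.ofBijective l (Finite.injective_iff_bijective.mp hinj)).apply_symm_apply j
    have htri : ((M.submatrix σ (Equiv.refl n))⁻¹).BlockTriangular id := by
      rw [Matrix.inv_submatrix_equiv]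
      intro i j hij
      exact hlast (σ j) i (by rw [hσ]; exact hij)
    have hu : IsUnit (M.submatrix σ (Equiv.refl n)) :=
      (Matrix.isUnit_submatrix_equiv σ (Equiv.refl n)).mpr
        ((Matrix.isUnit_iff_isUnit_det M).mpr hdet)
    have hu' := (Matrix.isUnit_iff_isUnit_det _).mp hu
    let _ := Matrix.invertibleOfIsUnitDet _ (Matrix.isUnit_nonsing_inv_det _ hu')
    have := Matrix.blockTriangular_inv_of_blockTriangular htri
    rw [Matrix.nonsing_inv_nonsing_inv _ hu'] at this
    exact hM σ fun i j hij => this hij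
  obtain ⟨a, b, hab, hne⟩ := Function.not_injective_iff.mp hinj
  refine ⟨a, b, l a, hne, hl a, hab ▸ hl b, fun i hi => ⟨hlast a i hi, hlast b i ?_⟩⟩
  exact hab ▸ hi

theorem Equiv.Perm.exists_apply_eq_apply_eq {β : Type*} {x y a b : β} (hxy : x ≠ y)
    (hab : a ≠ b) : ∃ σ : Equiv.Perm β, σ x = a ∧ σ y = b := by
  classical
  refine ⟨(Equiv.swap y (Equiv.swap x a b)).trans (Equiv.swap x a), ?_, by simp⟩
  have h : x ≠ Equiv.swap x a b := by
    intro h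
    simp only [Equiv.swap_apply_def] at h
    grind
  rw [Equiv.trans_apply, Equiv.swap_apply_of_ne_of_ne hxy h, Equiv.swap_apply_left]

/-- every mixing matrix contains `H = [[1,0],[α,1]]` (for some `α ≠ 0`)
in a useful way. -/
theorem stmt6 (q : ℕ) (hq : Nat.Prime q) {k : ℕ}
    (M : Matrix (Fin k) (Fin k) (ZMod q)) (hM : IsMixing M) :
    ∃ α : ZMod q, α ≠ 0 ∧
      UsefulContains (!![1, 0; α, 1] : Matrix (Fin 2) (Fin 2) (ZMod q)) M := by
  have : Fact q.Prime := ⟨hq⟩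
  obtain ⟨a, b, r, hab, ha, hb, hlast⟩ := Matrix.exists_columns_inv_same_last hM.1 hM.2
  have hk : 2 ≤ k := by
    have := Fin.val_ne_of_ne hab
    omega
  obtain ⟨σ, hσ₀, hσ₁⟩ := Equiv.Perm.exists_apply_eq_apply_eq
    (x := (⟨0, by omega⟩ : Fin k)) (y := ⟨1, by omega⟩) (by simp) hab
  have hmul (i c : Fin k) : ∑ s, M i s * M⁻¹ s c = if i = c then 1 else 0 := by
    rw [← Matrix.mul_apply, M.mul_nonsing_inv hM.1, Matrix.one_apply]
  have hσa (i : Fin k) : σ i = a ↔ (i : ℕ) = 0 := by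
    rw [← hσ₀, σ.apply_eq_iff_eq, Fin.ext_iff]
  have hσb (i : Fin k) : σ i = b ↔ (i : ℕ) = 1 := by
    rw [← hσ₁, σ.apply_eq_iff_eq, Fin.ext_iff]
  let α := -(M⁻¹ r a / M⁻¹ r b)
  refine ⟨α, neg_ne_zero.mpr (div_ne_zero ha hb),
    Matrix.of fun s => ![M⁻¹ s a + α * M⁻¹ s b, M⁻¹ s b], σ, r, M⁻¹ r b, hb, ?_, ?_, ?_⟩
  · intro i j
    rw [Matrix.mul_apply]
    fin_cases j
    · have : ∑ s, M (σ i) s * (M⁻¹ s a + α * M⁻¹ s b) =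
          (if (i : ℕ) = 0 then 1 else 0) + α * if (i : ℕ) = 1 then 1 else 0 := by
        simp only [mul_add, Finset.sum_add_distrib, mul_left_comm _ α, ← Finset.mul_sum, hmul,
          hσa, hσb]
      obtain ⟨_ | _ | i, hi⟩ := i <;> simpa using this
    · have : ∑ s, M (σ i) s * M⁻¹ s b = if (i : ℕ) = 1 then 1 else 0 := by
        simp only [hmul, hσb]
      obtain ⟨_ | _ | i, hi⟩ := i <;> simpa using this
  · intro i hi j
    fin_cases j <;> simp [hlast i hi]
  · intro j
    fin_cases j
    · simp [α, hb]
    · simp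
end
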